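/- arXiv:1911.01958 — 2 statements merged into one kernel-verified Lean document; each statement's English description precedes it below -/
import Mathlib

section
/- For a binary form f of degree d ≥ 1 over ℂ (or ℝ), the Waring rank (minimum r such that f is a sum of r scalar multiples of d-th powers of linear forms) of a generic complex binary form of degree d equals ⌈(d+1)/2⌉. -/
open MvPolynomial

noncomputable section

/-- The Zariski closure of a subset of the affine space `σ → K`. -/
def zClosure {K : Type} [Field K] {σ : Type} [Fintype σ] [DecidableEq σ]
    (S : Set (σ → K)) : Set (σ → K) :=
  {x | ∀ p : MvPolynomial σ K, (∀ y ∈ S, eval y p = 0) → eval x p = 0}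

/-- A subset of affine space is Zariski closed if it equals its Zariski closure. -/
def zClosed {K : Type} [Field K] {σ : Type} [Fintype σ] [DecidableEq σ]
    (S : Set (σ → K)) : Prop :=
  zClosure S = S

/-- Irreducibility of a subset of affine space in the Zariski topology,
tested against the basic open sets. -/
def zIrreducible {K : Type} [Field K] {σ : Type} [Fintype σ] [DecidableEq σ]
    (S : Set (σ → K)) : Prop :=
  S.Nonempty ∧ ∀ p q : MvPolynomial σ K,
    (∀ x ∈ S, eval x p = 0 ∨ eval x q = 0) →
    (∀ x ∈ S, eval x p = 0) ∨ (∀ x ∈ S, eval x q = 0)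

/-- There is a strictly increasing chain of `m+1` irreducible Zariski-closed
subsets contained in `S`. -/
def zChain {K : Type} [Field K] {σ : Type} [Fintype σ] [DecidableEq σ]
    (S : Set (σ → K)) (m : ℕ) : Prop :=
  ∃ c : Fin (m+1) → Set (σ → K),
    (∀ i, zIrreducible (c i) ∧ zClosed (c i) ∧ c i ⊆ S) ∧
    ∀ i j : Fin (m+1), i < j → c i ⊂ c j

/-- `S` has (Krull) dimension `m` in the Zariski topology. -/
def zDimEq {K : Type} [Field K] {σ : Type} [Fintype σ] [DecidableEq σ]
    (S : Set (σ → K)) (m : ℕ) : Prop :=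
  zChain S m ∧ ¬ zChain S (m+1)

/-- The (embedded, affine) Zariski tangent space to `S` at `a`: the common kernel of the
differentials at `a` of all polynomials vanishing on `S`. -/
def zTangentAt {K : Type} [Field K] {σ : Type} [Fintype σ] [DecidableEq σ]
    (S : Set (σ → K)) (a : σ → K) : Set (σ → K) :=
  {v | ∀ p : MvPolynomial σ K, (∀ y ∈ S, eval y p = 0) →
        ∑ i : σ, eval a (pderiv i p) * v i = 0}

/-- Dimension of the Zariski tangent space at a point. -/
def zTangentDim {K : Type} [Field K] {σ : Type} [Fintype σ] [DecidableEq σ]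
    (S : Set (σ → K)) (a : σ → K) : ℕ :=
  Module.finrank K (Submodule.span K (zTangentAt S a))

/-- The binary form of degree `r` with coefficient vector `a`. -/
def binForm {K : Type} [CommSemiring K] (r : ℕ) (a : Fin (r+1) → K) :
    MvPolynomial (Fin 2) K :=
  ∑ i : Fin (r+1), C (a i) * X 0 ^ (r - (i : ℕ)) * X 1 ^ (i : ℕ)

/-- The linear binary form `u·x + v·y`. -/
def linForm {K : Type} [CommSemiring K] (u v : K) : MvPolynomial (Fin 2) K :=
  C u * X 0 + C v * X 1

/-- The affine cone over the coincident root locus `Δ_λ ⊆ ℙ^r`, in coefficient coordinates: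
scalar multiples of forms `∏ ℓ_i ^ λ_i`. -/
def crlCone (r n : ℕ) (lam : Fin n → ℕ) : Set (Fin (r+1) → ℂ) :=
  {a | ∃ (t : ℂ) (u v : Fin n → ℂ),
    binForm r a = C t * ∏ i, (linForm (u i) (v i)) ^ lam i}

/-- `lam` is a partition of `r` of length `n` (all parts positive). -/
def isPartitionOf (r n : ℕ) (lam : Fin n → ℕ) : Prop :=
  (∀ i, 1 ≤ lam i) ∧ ∑ i, lam i = r

/-- The multiplicity `m_j` of the part `j` in the partition `lam`. -/
def multOf {n : ℕ} (lam : Fin n → ℕ) (jj : ℕ) : ℕ :=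
  (Finset.univ.filter fun i => lam i = jj).card

/-- The differential operator of degree `s` with coefficient vector `b`, i.e.
`∑ b_i ∂x^(s-i) ∂y^i`, applied to `f`. -/
def diffOp {K : Type} [CommSemiring K] (s : ℕ) (b : Fin (s+1) → K)
    (f : MvPolynomial (Fin 2) K) : MvPolynomial (Fin 2) K :=
  ∑ i : Fin (s+1), b i •
    ((fun g => pderiv (0 : Fin 2) g)^[s - (i : ℕ)]
      (((fun g => pderiv (1 : Fin 2) g)^[(i : ℕ)]) f))

/-- The apolarity pairing between a degree-`d` operator (coefficients `h`) and a
degree-`d` form (coefficients `a`). -/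
def apolarPair (d : ℕ) (h a : Fin (d+1) → ℂ) : ℂ :=
  eval (fun _ => (0 : ℂ)) (diffOp d h (binForm d a))

/-- The cone over the dual variety of the cone `S ⊆ ℂ^(m+1)` (with `k` the dimension of the
cone `S`, used to select smooth points): closure of the set of hyperplanes, written in dual
coordinates via the apolarity pairing, containing an embedded tangent space at a smooth point. -/
def dualConeOf (m : ℕ) (S : Set (Fin (m+1) → ℂ)) (k : ℕ) : Set (Fin (m+1) → ℂ) :=
  zClosure {h | h ≠ 0 ∧ ∃ a ∈ S, a ≠ 0 ∧ zTangentDim S a = k ∧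
      ∀ v ∈ zTangentAt S a, apolarPair m h v = 0}

/-- The row span of a matrix, as a subspace of `ℂ^m`. -/
def rowSpan {k m : ℕ} (M : Matrix (Fin k) (Fin m) ℂ) : Submodule ℂ (Fin m → ℂ) :=
  Submodule.span ℂ (Set.range fun i => M i)

/-- The (redundant) Plücker coordinate vector of the row span of `M`: all maximal minors. -/
def plucker {k m : ℕ} (M : Matrix (Fin k) (Fin m) ℂ) : (Fin k → Fin m) → ℂ :=
  fun s => (M.submatrix id s).det

/-- The degree-`s` component of the apolar ideal of the degree-`d` form with
coefficients `a`, as a subset of the coefficient space of operators. -/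
def apolarSet (d s : ℕ) (a : Fin (d+1) → ℂ) : Set (Fin (s+1) → ℂ) :=
  {b | diffOp s b (binForm d a) = 0}

/-- The (pre-closure) cone, in Plücker coordinates, over the `j`-th higher associated variety
`CH_j(S)`: spans of `k`-row matrices whose row space contains a smooth point `x` of the cone
`S` (`dimS` = dimension of the cone `S`) and meets the tangent space at `x` in projective
dimension at least `j`. -/
def smoothCHCone (m : ℕ) (S : Set (Fin (m+1) → ℂ)) (dimS k j : ℕ) :
    Set ((Fin k → Fin (m+1)) → ℂ) :=
  {u | ∃ M : Matrix (Fin k) (Fin (m+1)) ℂ, u = plucker M ∧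
    Module.finrank ℂ (rowSpan M) = k ∧
    ∃ x, x ≠ 0 ∧ x ∈ S ∧ zTangentDim S x = dimS ∧ x ∈ rowSpan M ∧
      j + 1 ≤ Module.finrank ℂ ↥(rowSpan M ⊓ Submodule.span ℂ (zTangentAt S x))}

/-- The (pre-closure) cone, in Plücker coordinates, over `Ξ_0(S)`: spans of `k`-row matrices
whose row space meets the cone `S` nontrivially. -/
def meetCone (m : ℕ) (S : Set (Fin (m+1) → ℂ)) (k : ℕ) :
    Set ((Fin k → Fin (m+1)) → ℂ) :=
  {u | ∃ M : Matrix (Fin k) (Fin (m+1)) ℂ, u = plucker M ∧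
    Module.finrank ℂ (rowSpan M) = k ∧ ∃ x, x ≠ 0 ∧ x ∈ S ∧ x ∈ rowSpan M}

/-- The preimage under the apolar map `Ψ_{d,s}` of a subset `T` of the Grassmannian
(in Plücker coordinates) of `(k-1)`-projective-dimensional subspaces of `ℙ(D_s)`. -/
def apolarPull (d s k : ℕ) (T : Set ((Fin k → Fin (s+1)) → ℂ)) : Set (Fin (d+1) → ℂ) :=
  {a | ∃ M : Matrix (Fin k) (Fin (s+1)) ℂ,
    rowSpan M = Submodule.span ℂ (apolarSet d s a) ∧
    Module.finrank ℂ (rowSpan M) = k ∧ plucker M ∈ T}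

/-- The Waring rank over `K` of a binary form: the least `r` such that `f` is a sum of `r`
scalar multiples of `d`-th powers of linear forms. -/
def waringRank {K : Type} [Field K] (d : ℕ) (f : MvPolynomial (Fin 2) K) : ℕ :=
  sInf {r | ∃ (α u v : Fin r → K), f = ∑ i, α i • (linForm (u i) (v i)) ^ d}

/-- The set of coefficient vectors of real binary forms of degree `d` of real rank `r`. -/
def realRankSet (d r : ℕ) : Set (Fin (d+1) → ℝ) :=
  {a | waringRank d (binForm d a) = r}

/-- `R_{d,r}`: the interior, in the Euclidean topology, of the set of real binary forms of
degree `d` and real rank `r`. -/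
def Rdr (d r : ℕ) : Set (Fin (d+1) → ℝ) := interior (realRankSet d r)

/-- The topological boundary of `R_{d,r}`: the closure of `R_{d,r}` minus the interior of
the closure. -/
def topBoundary (d r : ℕ) : Set (Fin (d+1) → ℝ) :=
  closure (Rdr d r) \ interior (closure (Rdr d r))

/-- The algebraic boundary `∂_alg(R_{d,r})`: the Zariski closure over `ℂ` of the topological
boundary of `R_{d,r}`. -/
def algBoundary (d r : ℕ) : Set (Fin (d+1) → ℂ) :=
  zClosure ((fun a i => ((a i : ℝ) : ℂ)) '' topBoundary d r)


/-- Hankel matrix of a sequence. -/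
def wrHank {A : Type} [CommRing A] (m : ℕ) (c : ℕ → A) : Matrix (Fin (m+1)) (Fin (m+1)) A :=
  Matrix.of fun i j => c (i + j)

/-- Cramer-type solution of the recurrence system. -/
def wrVec {A : Type} [CommRing A] (m : ℕ) (c : ℕ → A) : Fin (m+1) → A :=
  (wrHank m c).adjugate.mulVec (fun i => c (i + (m+1)))

/-- The apolar generator polynomial. -/
def wrPoly {A : Type} [CommRing A] (m : ℕ) (c : ℕ → A) : Polynomial A :=
  Polynomial.C (wrHank m c).det * Polynomial.X ^ (m+1)
    - ∑ j : Fin (m+1), Polynomial.C (wrVec m c j) * Polynomial.X ^ (j : ℕ)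

/-- The genericity condition. -/
def wrCond {A : Type} [CommRing A] (m : ℕ) (c : ℕ → A) : A :=
  (wrHank m c).det * Polynomial.resultant (wrPoly m c) (Polynomial.derivative (wrPoly m c)) (m+1) m

theorem wrHank_map {A B : Type} [CommRing A] [CommRing B] (φ : A →+* B) (m : ℕ) (c : ℕ → A) :
    wrHank m (fun i => φ (c i)) = φ.mapMatrix (wrHank m c) := by
  ext i j; simp [wrHank]

theorem wrVec_map {A B : Type} [CommRing A] [CommRing B] (φ : A →+* B) (m : ℕ) (c : ℕ → A)
    (j : Fin (m+1)) : wrVec m (fun i => φ (c i)) j = φ (wrVec m c j) := by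
  unfold wrVec
  rw [wrHank_map, ← RingHom.map_adjugate, RingHom.map_mulVec]
  rfl

theorem wrPoly_map {A B : Type} [CommRing A] [CommRing B] (φ : A →+* B) (m : ℕ) (c : ℕ → A) :
    wrPoly m (fun i => φ (c i)) = (wrPoly m c).map φ := by
  unfold wrPoly
  simp only [wrVec_map, wrHank_map, ← RingHom.map_det]
  simp [Polynomial.map_sum]

theorem wrCond_map {A B : Type} [CommRing A] [CommRing B] (φ : A →+* B) (m : ℕ) (c : ℕ → A) :
    wrCond m (fun i => φ (c i)) = φ (wrCond m c) := by
  unfold wrCond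
  rw [wrPoly_map, wrHank_map, ← RingHom.map_det, Polynomial.derivative_map,
    Polynomial.resultant_map_map, map_mul]

theorem wr_recurrence {A : Type} [CommRing A] (m : ℕ) (c : ℕ → A) (i : Fin (m+1)) :
    (wrHank m c).det * c (i + (m+1)) = ∑ j : Fin (m+1), wrVec m c j * c (i + j) := by
  have h : (wrHank m c).mulVec (wrVec m c) = (wrHank m c).det • (fun i : Fin (m+1) => c (i + (m+1))) := by
    unfold wrVec
    rw [Matrix.mulVec_mulVec, Matrix.mul_adjugate, Matrix.smul_mulVec, Matrix.one_mulVec]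
  have := congrFun h i
  simp only [Matrix.mulVec, dotProduct, Pi.smul_apply, smul_eq_mul] at this
  rw [← this]
  refine Finset.sum_congr rfl fun j _ => ?_
  simp [wrHank, mul_comm]

theorem wrPoly_natDegree (m : ℕ) (c : ℕ → ℂ) (hD : (wrHank m c).det ≠ 0) :
    (wrPoly m c).natDegree = m + 1 := by
  unfold wrPoly
  rw [Polynomial.natDegree_sub_eq_left_of_natDegree_lt]
  · exact Polynomial.natDegree_C_mul_X_pow _ _ hD
  · rw [Polynomial.natDegree_C_mul_X_pow _ _ hD]
    refine Nat.lt_succ_of_le (Polynomial.natDegree_sum_le_of_forall_le _ _ fun j _ => ?_)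
    exact (Polynomial.natDegree_C_mul_X_pow_le _ _).trans (by omega)

theorem wrPoly_eval (m : ℕ) (c : ℕ → ℂ) (t : ℂ) :
    (wrPoly m c).eval t = (wrHank m c).det * t ^ (m+1) - ∑ j : Fin (m+1), wrVec m c j * t ^ (j : ℕ) := by
  simp [wrPoly, Polynomial.eval_finsetSum]

theorem wrCond_ne_zero_iff (m : ℕ) (c : ℕ → ℂ) :
    wrCond m c ≠ 0 ↔ (wrHank m c).det ≠ 0 ∧ (wrPoly m c).roots.Nodup := by
  unfold wrCond
  rw [mul_ne_zero_iff]
  refine and_congr_right fun hD => ?_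
  have hdeg := wrPoly_natDegree m c hD
  have h0 : wrPoly m c ≠ 0 := by
    intro h; rw [h] at hdeg; simp at hdeg
  have hdeg' : (Polynomial.derivative (wrPoly m c)).natDegree = m := by
    rw [Polynomial.natDegree_derivative, hdeg]; rfl
  rw [Polynomial.nodup_roots_iff_of_splits h0 (IsAlgClosed.splits _), Polynomial.Separable]
  have := Polynomial.resultant_eq_zero_iff (f := wrPoly m c) (g := Polynomial.derivative (wrPoly m c))
  rw [hdeg, hdeg'] at this
  rw [Ne, this]
  simp [h0]

theorem wr_upper (m : ℕ) (c : ℕ → ℂ) (h : wrCond m c ≠ 0) :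
    ∃ α t : Fin (m+1) → ℂ, ∀ i, i ≤ 2*m+1 → c i = ∑ j, α j * t j ^ i := by
  obtain ⟨hD, hn⟩ := (wrCond_ne_zero_iff m c).1 h
  have hdeg := wrPoly_natDegree m c hD
  have h0 : wrPoly m c ≠ 0 := by
    intro h; rw [h] at hdeg; simp at hdeg
  have hcard : (wrPoly m c).roots.toFinset.card = m + 1 := by
    rw [Multiset.toFinset_card_of_nodup hn, ← hdeg]
    exact (IsAlgClosed.splits (wrPoly m c)).natDegree_eq_card_roots.symm
  let e := (Finset.equivFinOfCardEq hcard).symm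
  let t : Fin (m+1) → ℂ := fun j => (e j : ℂ)
  have ht : Function.Injective t := fun i j hij => e.injective (Subtype.ext hij)
  have hroot : ∀ k, (wrHank m c).det * t k ^ (m+1) = ∑ j : Fin (m+1), wrVec m c j * t k ^ (j : ℕ) := by
    intro k
    have h1 : (wrPoly m c).eval (t k) = 0 := by
      have := (e k).2
      rw [Multiset.mem_toFinset, Polynomial.mem_roots h0] at this
      exact this
    rw [wrPoly_eval] at h1
    exact sub_eq_zero.1 h1
  have hV : IsUnit (Matrix.vandermonde t).det :=
    isUnit_iff_ne_zero.2 (Matrix.det_vandermonde_ne_zero_iff.2 ht)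
  let α : Fin (m+1) → ℂ := Matrix.vecMul (fun i : Fin (m+1) => c i) (Matrix.vandermonde t)⁻¹
  have hα : Matrix.vecMul α (Matrix.vandermonde t) = fun i : Fin (m+1) => c i := by
    simp only [α]
    rw [Matrix.vecMul_vecMul, Matrix.nonsing_inv_mul _ hV, Matrix.vecMul_one]
  refine ⟨α, t, fun n => ?_⟩
  induction n using Nat.strong_induction_on with
  | _ n ih =>
    intro hn
    by_cases hlt : n < m + 1
    · have := congrFun hα ⟨n, hlt⟩
      simp only [Matrix.vecMul, dotProduct, Matrix.vandermonde_apply] at this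
      exact this.symm
    · obtain ⟨i, rfl⟩ : ∃ i, n = i + (m+1) := ⟨n - (m+1), by omega⟩
      have hi : i < m + 1 := by omega
      apply mul_left_cancel₀ hD
      rw [wr_recurrence m c ⟨i, hi⟩]
      have h1 : ∀ j : Fin (m+1), wrVec m c j * c (i + j)
          = ∑ k, wrVec m c j * (α k * t k ^ (i + (j:ℕ))) := by
        intro j
        rw [ih (i + j) (by omega) (by omega), Finset.mul_sum]
      simp only [h1]
      rw [Finset.sum_comm, Finset.mul_sum]
      refine Finset.sum_congr rfl fun k _ => ?_
      have := hroot k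
      calc _ = α k * t k ^ i * ∑ j : Fin (m+1), wrVec m c j * t k ^ (j : ℕ) := by
            rw [Finset.mul_sum]
            refine Finset.sum_congr rfl fun j _ => ?_
            rw [pow_add]; ring
        _ = _ := by rw [← this, pow_add]; ring

/-- The sample sequence of power sums. -/
def wrSample (m : ℕ) (i : ℕ) : ℂ := ∑ k : Fin (m+1), ((k : ℕ) : ℂ) ^ i

theorem wrCond_sample (m : ℕ) : wrCond m (wrSample m) ≠ 0 := by
  let t : Fin (m+1) → ℂ := fun k => ((k : ℕ) : ℂ)
  have ht : Function.Injective t := fun i j hij => Fin.ext (Nat.cast_injective (R := ℂ) hij)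
  have hV : (Matrix.vandermonde t).det ≠ 0 := Matrix.det_vandermonde_ne_zero_iff.2 ht
  have hH : wrHank m (wrSample m) = (Matrix.vandermonde t).transpose * Matrix.vandermonde t := by
    ext i j
    rw [Matrix.vandermonde_transpose_mul_vandermonde]
    rfl
  have hD : (wrHank m (wrSample m)).det ≠ 0 := by
    rw [hH, Matrix.det_mul, Matrix.det_transpose]
    exact mul_ne_zero hV hV
  rw [wrCond_ne_zero_iff]
  refine ⟨hD, ?_⟩
  have hdeg := wrPoly_natDegree m _ hD
  have h0 : wrPoly m (wrSample m) ≠ 0 := by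
    intro h; rw [h] at hdeg; simp at hdeg
  have hz : (fun k => (wrPoly m (wrSample m)).eval (t k)) = 0 := by
    have hu : IsUnit (Matrix.vandermonde t) :=
      (Matrix.isUnit_iff_isUnit_det _).2 (isUnit_iff_ne_zero.2 hV)
    apply Matrix.vecMul_injective_of_isUnit hu
    change Matrix.vecMul _ _ = Matrix.vecMul _ _
    rw [Matrix.zero_vecMul]
    ext i
    simp only [Matrix.vecMul, dotProduct, Matrix.vandermonde_apply, wrPoly_eval, Pi.zero_apply]
    have hr := wr_recurrence m (wrSample m) i
    simp only [sub_mul, Finset.sum_sub_distrib]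
    rw [sub_eq_zero]
    have h2 : (wrHank m (wrSample m)).det * wrSample m (i + (m+1)) =
        ∑ x, (wrHank m (wrSample m)).det * t x ^ (m + 1) * t x ^ (i : ℕ) := by
      rw [wrSample, Finset.mul_sum]
      refine Finset.sum_congr rfl fun k _ => ?_
      rw [pow_add]; ring
    rw [← h2, hr]
    simp only [Finset.sum_mul]
    rw [Finset.sum_comm]
    refine Finset.sum_congr rfl fun j _ => ?_
    rw [wrSample, Finset.mul_sum]
    refine Finset.sum_congr rfl fun k _ => ?_
    rw [pow_add]; ring
  have hle : (Finset.univ.image t).val ≤ (wrPoly m (wrSample m)).roots := by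
    rw [Multiset.le_iff_subset (Finset.nodup _)]
    intro x hx
    rw [Finset.mem_val, Finset.mem_image] at hx
    obtain ⟨k, -, rfl⟩ := hx
    rw [Polynomial.mem_roots h0]
    exact congrFun hz k
  have heq := Multiset.eq_of_le_of_card_le hle (by
    rw [Finset.card_val, Finset.card_image_of_injective _ ht, Finset.card_univ, Fintype.card_fin,
      ← hdeg]
    exact Polynomial.card_roots' _)
  rw [← heq]
  exact Finset.nodup _

theorem wr_lower (d m k : ℕ) (hm : 2 * m ≤ d) (c : ℕ → ℂ) (hD : (wrHank m c).det ≠ 0)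
    (α u v : Fin k → ℂ) (h : ∀ i, i ≤ d → c i = ∑ j, α j * (u j ^ (d - i) * v j ^ i)) :
    m + 1 ≤ k := by
  let M : Matrix (Fin (m+1)) (Fin k) ℂ := Matrix.of fun i l => α l * (u l ^ (m - (i:ℕ)) * v l ^ (i:ℕ))
  let N : Matrix (Fin k) (Fin (m+1)) ℂ := Matrix.of fun l j => u l ^ (d - m - (j:ℕ)) * v l ^ (j:ℕ)
  have hH : wrHank m c = M * N := by
    ext i j
    simp only [wrHank, Matrix.of_apply, Matrix.mul_apply, M, N]
    rw [h _ (by omega)]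
    refine Finset.sum_congr rfl fun l _ => ?_
    have : d - ((i:ℕ) + j) = (m - i) + (d - m - j) := by omega
    rw [this, pow_add, pow_add]; ring
  have h1 : (wrHank m c).rank = m + 1 := by
    rw [Matrix.rank_of_isUnit _ ((Matrix.isUnit_iff_isUnit_det _).2 (isUnit_iff_ne_zero.2 hD)),
      Fintype.card_fin]
  rw [← h1, hH]
  exact (Matrix.rank_mul_le_left M N).trans (Matrix.rank_le_width M)

theorem binForm_coeff (d : ℕ) (a : Fin (d+1) → ℂ) (i : Fin (d+1)) :
    coeff (Finsupp.single 0 (d - (i:ℕ)) + Finsupp.single 1 (i:ℕ)) (binForm d a) = a i := by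
  unfold binForm
  rw [coeff_sum, Finset.sum_eq_single i]
  · rw [mul_assoc, coeff_C_mul, X_pow_eq_monomial, X_pow_eq_monomial, monomial_mul, coeff_monomial]
    simp
  · intro j _ hj
    rw [mul_assoc, coeff_C_mul, X_pow_eq_monomial, X_pow_eq_monomial, monomial_mul, coeff_monomial,
      if_neg]
    · simp
    · intro h
      have := DFunLike.congr_fun h 1
      simp at this
      exact hj (Fin.ext this)
  · simp

theorem linForm_pow (d : ℕ) (u v : ℂ) :
    linForm u v ^ d = binForm d (fun i => (d.choose i : ℂ) * (u ^ (d - (i:ℕ)) * v ^ (i:ℕ))) := by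
  unfold linForm binForm
  rw [add_comm, add_pow, Finset.sum_range]
  refine Finset.sum_congr rfl fun i _ => ?_
  simp only [mul_pow, map_mul, map_pow, map_natCast]
  ring

theorem binForm_eq_iff (d k : ℕ) (a : Fin (d+1) → ℂ) (α u v : Fin k → ℂ) :
    binForm d a = ∑ i, α i • (linForm (u i) (v i)) ^ d ↔
    ∀ i : Fin (d+1), a i = (d.choose i : ℂ) * ∑ j, α j * (u j ^ (d - (i:ℕ)) * v j ^ (i:ℕ)) := by
  have key : ∑ i, α i • (linForm (u i) (v i)) ^ d =
      binForm d (fun i => (d.choose i : ℂ) * ∑ j, α j * (u j ^ (d - (i:ℕ)) * v j ^ (i:ℕ))) := by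
    simp only [linForm_pow]
    unfold binForm
    simp only [Finset.smul_sum, smul_eq_C_mul]
    rw [Finset.sum_comm]
    refine Finset.sum_congr rfl fun i _ => ?_
    simp only [map_mul, map_sum, Finset.mul_sum, Finset.sum_mul]
    refine Finset.sum_congr rfl fun j _ => ?_
    ring
  rw [key]
  constructor
  · intro h i
    rw [← binForm_coeff d a i, h, binForm_coeff]
  · intro h
    exact congrArg _ (funext h)

/-- Normalised coefficients of the generic form, extended by constants. -/
def wrGen (d : ℕ) (i : ℕ) : MvPolynomial (Fin (d+1)) ℂ :=
  if h : i < d + 1 then C ((d.choose i : ℂ)⁻¹) * X ⟨i, h⟩ else C (wrSample (d/2) i)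

/-- The Waring rank of a generic complex binary form of degree `d ≥ 1` is
`⌈(d+1)/2⌉ = (d+2)/2`: there is a nonempty Zariski-open subset of the coefficient space on
which the rank is exactly this value. -/
theorem generic_complex_rank_binary (d : ℕ) (hd : 1 ≤ d) :
    ∃ P : MvPolynomial (Fin (d+1)) ℂ, P ≠ 0 ∧
      ∀ a : Fin (d+1) → ℂ, eval a P ≠ 0 →
        waringRank d (binForm d a) = (d + 2) / 2 := by
  have hch : ∀ i, i < d + 1 → (d.choose i : ℂ) ≠ 0 := fun i hi => by
    exact_mod_cast (Nat.choose_pos (by omega)).ne'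
  refine ⟨wrCond (d/2) (wrGen d), ?_, ?_⟩
  · intro h
    apply wrCond_sample (d/2)
    have h1 := wrCond_map (eval (fun i : Fin (d+1) => (d.choose i : ℂ) * wrSample (d/2) i)) (d/2) (wrGen d)
    rw [h, map_zero] at h1
    rw [← h1]
    congr 1
    funext i
    unfold wrGen
    split_ifs with hi
    · simp [hch i hi]
    · simp
  · intro a ha
    rw [← wrCond_map] at ha
    set c : ℕ → ℂ := fun i => eval a (wrGen d i) with hc
    have hca : ∀ i : Fin (d+1), a i = (d.choose i : ℂ) * c i := by
      intro i
      have h1 : c i = (d.choose i : ℂ)⁻¹ * a i := by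
        simp only [hc, wrGen]
        rw [dif_pos i.2]
        simp
      rw [h1, mul_inv_cancel_left₀ (hch i i.2)]
    have hD := ((wrCond_ne_zero_iff _ _).1 ha).1
    have e : (d+2)/2 = d/2 + 1 := by omega
    rw [e]
    unfold waringRank
    apply IsLeast.csInf_eq
    constructor
    · obtain ⟨α, t, hαt⟩ := wr_upper _ c ha
      refine ⟨α, fun _ => 1, t, ?_⟩
      rw [binForm_eq_iff]
      intro i
      rw [hca i, hαt i (by omega)]
      simp
    · rintro k ⟨α, u, v, hk⟩
      rw [binForm_eq_iff] at hk
      refine wr_lower d (d/2) k (by omega) c hD α u v fun i hi => ?_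
      have h1 := hk ⟨i, by omega⟩
      rw [hca] at h1
      exact mul_left_cancel₀ (hch i (by omega)) h1
end
end

section
/- For a partition λ = [λ_1,…,λ_n] of r with m_j parts equal to j, the degree of the coincident root locus Δ_λ ⊂ ℙ^r equals (n! / (m_1! m_2! ⋯ m_k!)) · λ_1 λ_2 ⋯ λ_n. -/
open MvPolynomial

noncomputable section

open Filter Topology in
lemma local_root {E : Type} [NormedAddCommGroup E] [NormedSpace ℂ E] (q : E → ℂ) (a : E)
    (hq : ContDiffAt ℂ 1 q a) (hqa : q a ≠ 0) (m : ℕ) (hm : 1 ≤ m) :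
    ∃ R : E → ℂ, ContDiffAt ℂ 1 R a ∧ R a ≠ 0 ∧ ∀ᶠ z in 𝓝 a, R z ^ m = q z := by
  obtain ⟨c, hc⟩ := IsAlgClosed.exists_pow_nat_eq (q a) hm
  have hc0 : c ≠ 0 := by
    rintro rfl
    apply hqa; rw [← hc, zero_pow (by omega)]
  have hm0 : (m : ℂ) ≠ 0 := by exact_mod_cast (by omega : m ≠ 0)
  have hdiv : ContDiffAt ℂ 1 (fun z => q z / q a) a := hq.div_const _
  refine ⟨fun z => c * Complex.exp (Complex.log (q z / q a) / m), ?_, ?_, ?_⟩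
  · refine contDiffAt_const.mul (ContDiffAt.cexp (ContDiffAt.div_const ?_ _))
    refine (Complex.contDiffAt_log (n := 1) ?_).comp a hdiv
    rw [div_self hqa]; exact Complex.one_mem_slitPlane
  · simp [hc0, Complex.exp_ne_zero]
  · filter_upwards [hq.continuousAt.eventually_ne hqa] with z hz
    rw [mul_pow, hc, ← Complex.exp_nat_mul, mul_div_cancel₀ _ hm0, Complex.exp_log (div_ne_zero hz hqa)]
    field_simp

open Filter Topology in
lemma card_roots_pi {n : ℕ} (lam : Fin n → ℕ) (hlam : ∀ i, 1 ≤ lam i) (ε : ℂ) (hε : ε ≠ 0) :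
    {y : Fin n → ℂ | ∀ i, y i ^ lam i = ε}.ncard = ∏ i, lam i := by
  classical
  have : {y : Fin n → ℂ | ∀ i, y i ^ lam i = ε} =
      ((Fintype.piFinset fun i => (Polynomial.nthRoots (lam i) ε).toFinset : Finset (Fin n → ℂ)) :
        Set (Fin n → ℂ)) := by
    ext y
    simp only [Set.mem_setOf_eq, Finset.mem_coe, Fintype.mem_piFinset, Multiset.mem_toFinset]
    exact forall_congr' fun i => (Polynomial.mem_nthRoots (hlam i)).symm
  rw [this, Set.ncard_coe_finset, Fintype.card_piFinset]
  refine Finset.prod_congr rfl fun i _ => ?_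
  have hprim := Complex.isPrimitiveRoot_exp (lam i) (by have := hlam i; omega)
  rw [Multiset.toFinset_card_of_nodup (hprim.nthRoots_nodup hε), hprim.card_nthRoots, if_pos]
  exact IsAlgClosed.exists_pow_nat_eq ε (hlam i)

open Filter Topology in
lemma local_count {n : ℕ} (lam : Fin n → ℕ) (hlam : ∀ i, 1 ≤ lam i) (p : Fin n → ℂ)
    (hp : Function.Injective p) (g : Fin n → (Fin n → ℂ) → ℂ) (hg : ∀ k, ContDiff ℂ 1 (g k))
    (τ : Equiv.Perm (Fin n)) (hgτ : ∀ k, g k (p ∘ τ) ≠ 0) (U : Set (Fin n → ℂ)) (hU : IsOpen U)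
    (haU : p ∘ τ ∈ U) :
    ∃ W : Set (Fin n → ℂ), IsOpen W ∧ p ∘ τ ∈ W ∧ W ⊆ U ∧ ∀ᶠ ε in 𝓝[≠] (0 : ℂ),
      {z | z ∈ W ∧ ∀ k, ∏ i, (z i - p k) ^ lam i + ε * g k z = 0}.ncard = ∏ i, lam i := by
  classical
  set a : Fin n → ℂ := p ∘ τ with ha
  let q : Fin n → (Fin n → ℂ) → ℂ := fun i z =>
    (∏ j ∈ Finset.univ.erase i, (z j - p (τ i)) ^ lam j) / (- g (τ i) z)
  have hprodne : ∀ i, (∏ j ∈ Finset.univ.erase i, (a j - p (τ i)) ^ lam j) ≠ 0 := by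
    intro i
    refine Finset.prod_ne_zero_iff.2 fun j hj => pow_ne_zero _ (sub_ne_zero.2 fun h => ?_)
    exact (Finset.ne_of_mem_erase hj) (τ.injective (hp h))
  have hqa : ∀ i, q i a ≠ 0 := fun i => div_ne_zero (hprodne i) (neg_ne_zero.2 (hgτ _))
  have hqd : ∀ i, ContDiffAt ℂ 1 (q i) a := by
    intro i
    refine ContDiffAt.div ?_ (hg _).contDiffAt.neg (neg_ne_zero.2 (hgτ _))
    refine contDiffAt_prod fun j _ => ContDiffAt.pow ?_ _
    exact ((contDiff_apply ℂ ℂ j).contDiffAt).sub contDiffAt_const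
  choose R hRd hRa hR using fun i => local_root (q i) a (hqd i) (hqa i) (lam i) (hlam i)
  let Y : (Fin n → ℂ) → (Fin n → ℂ) := fun z i => (z i - a i) * R i z
  let D : (Fin n → ℂ) ≃L[ℂ] (Fin n → ℂ) := ContinuousLinearEquiv.piCongrRight fun i =>
    ContinuousLinearEquiv.unitsEquivAut ℂ (Units.mk0 (R i a) (hRa i))
  have hY : HasStrictFDerivAt Y (D : (Fin n → ℂ) →L[ℂ] (Fin n → ℂ)) a := by
    rw [hasStrictFDerivAt_pi']
    intro i
    have h1 : HasStrictFDerivAt (fun z : Fin n → ℂ => z i - a i)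
        (ContinuousLinearMap.proj i : (Fin n → ℂ) →L[ℂ] ℂ) a :=
      (ContinuousLinearMap.proj (R := ℂ) (φ := fun _ : Fin n => ℂ) i).hasStrictFDerivAt.sub_const _
    have h2 := h1.mul ((hRd i).hasStrictFDerivAt one_ne_zero)
    refine h2.congr_fderiv ?_
    ext v
    simp [D, mul_comm]
  let e := hY.toOpenPartialHomeomorph Y
  have hYe : ∀ z, e z = Y z := fun z => rfl
  have hae : a ∈ e.source := hY.mem_toOpenPartialHomeomorph_source
  let G : Set (Fin n → ℂ) := {z | ∀ i, R i z ^ lam i = q i z ∧ g (τ i) z ≠ 0}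
  have hG : G ∈ 𝓝 a := by
    refine eventually_all.2 fun i => (hR i).and ?_
    exact (hg (τ i)).continuous.continuousAt.eventually_ne (hgτ _)
  let W := e.source ∩ (U ∩ interior G)
  have hWo : IsOpen W := e.open_source.inter (hU.inter isOpen_interior)
  have haW : a ∈ W := ⟨hae, haU, mem_interior_iff_mem_nhds.2 hG⟩
  refine ⟨W, hWo, haW, fun z hz => hz.2.1, ?_⟩
  have himg : IsOpen (Y '' W) := e.isOpen_image_of_subset_source hWo (fun z hz => hz.1)
  have h0 : (0 : Fin n → ℂ) ∈ Y '' W := ⟨a, haW, by ext i; simp [Y]⟩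
  obtain ⟨ρ, hρ, hball⟩ := Metric.isOpen_iff.1 himg 0 h0
  have hsmall : ∀ᶠ ε in 𝓝 (0 : ℂ), ∀ i, ‖ε‖ < ρ ^ lam i := by
    refine eventually_all.2 fun i => ?_
    have : Tendsto (fun ε : ℂ => ‖ε‖) (𝓝 0) (𝓝 0) := by simpa using (continuous_norm (E := ℂ)).tendsto 0
    exact this.eventually_lt_const (pow_pos hρ _)
  filter_upwards [nhdsWithin_le_nhds hsmall, self_mem_nhdsWithin] with ε hε hε0
  have hε0 : ε ≠ 0 := hε0
  have heq : ∀ z ∈ W, (∀ k, ∏ i, (z i - p k) ^ lam i + ε * g k z = 0) ↔ ∀ i, Y z i ^ lam i = ε := by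
    intro z hz
    have hzG := interior_subset hz.2.2
    rw [← τ.forall_congr_right]
    refine forall_congr' fun i => ?_
    obtain ⟨hz1, hz2⟩ := hzG i
    rw [← Finset.mul_prod_erase _ _ (Finset.mem_univ i)]
    simp only [Y, mul_pow, hz1, q, ha, Function.comp]
    rw [mul_div_assoc', div_eq_iff (neg_ne_zero.2 hz2)]
    constructor
    · intro h; linear_combination h
    · intro h; linear_combination h
  rw [← card_roots_pi lam hlam ε hε0]
  have hinj : Set.InjOn Y {z | z ∈ W ∧ ∀ k, ∏ i, (z i - p k) ^ lam i + ε * g k z = 0} :=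
    fun x hx y hy h => e.injOn hx.1.1 hy.1.1 h
  rw [← Set.ncard_image_of_injOn hinj]
  congr 1
  ext y
  constructor
  · rintro ⟨z, ⟨hz, hz'⟩, rfl⟩
    exact (heq z hz).1 hz'
  · intro hy
    have : y ∈ Y '' W := by
      apply hball
      rw [mem_ball_zero_iff, pi_norm_lt_iff hρ]
      intro i
      refine lt_of_pow_lt_pow_left₀ (lam i) hρ.le ?_
      rw [← norm_pow, hy i]
      exact hε i
    obtain ⟨z, hz, rfl⟩ := this
    exact ⟨z, ⟨hz, (heq z hz).2 hy⟩, rfl⟩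
/-- the dehomogenised product of powers of linear forms -/
def bprod {R : Type} [CommRing R] {n : ℕ} (lam : Fin n → ℕ) (u v : Fin n → R) : Polynomial R :=
  ∏ i, (Polynomial.C (u i) * Polynomial.X + Polynomial.C (v i)) ^ lam i

/-- value of the `k`-th linear functional on the product. -/
def hval {R : Type} [CommRing R] (r : ℕ) {n : ℕ} (lam : Fin n → ℕ) (h : Fin n × Fin (r+1) → R)
    (u v : Fin n → R) (k : Fin n) : R :=
  ∑ m : Fin (r+1), h (k, m) * (bprod lam u v).coeff (r - m)

lemma bprod_map {R S : Type} [CommRing R] [CommRing S] (φ : R →+* S) {n : ℕ} (lam : Fin n → ℕ)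
    (u v : Fin n → R) : (bprod lam u v).map φ = bprod lam (φ ∘ u) (φ ∘ v) := by
  simp [bprod, Polynomial.map_prod]

lemma hval_map {R S : Type} [CommRing R] [CommRing S] (φ : R →+* S) (r : ℕ) {n : ℕ}
    (lam : Fin n → ℕ) (h : Fin n × Fin (r+1) → R) (u v : Fin n → R) (k : Fin n) :
    φ (hval r lam h u v k) = hval r lam (φ ∘ h) (φ ∘ u) (φ ∘ v) k := by
  simp [hval, ← bprod_map]

lemma bprod_natDegree_le {R : Type} [CommRing R] {n : ℕ} (lam : Fin n → ℕ)
    (u v : Fin n → R) : (bprod lam u v).natDegree ≤ ∑ i, lam i := by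
  refine (Polynomial.natDegree_prod_le _ _).trans (Finset.sum_le_sum fun i _ => ?_)
  refine (Polynomial.natDegree_pow_le).trans ?_
  have : (Polynomial.C (u i) * Polynomial.X + Polynomial.C (v i)).natDegree ≤ 1 :=
    Polynomial.natDegree_linear_le
  simpa using Nat.mul_le_mul_left (lam i) this

lemma sum_rev_coeff {R : Type} [CommRing R] (r : ℕ) (P : Polynomial R) (hP : P.natDegree ≤ r) (c : R) :
    ∑ m : Fin (r+1), c ^ (r - (m : ℕ)) * P.coeff (r - m) = P.eval c := by
  rw [Polynomial.eval_eq_sum_range' (Nat.lt_succ_of_le hP),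
    Fin.sum_univ_eq_sum_range (fun m => c ^ (r - m) * P.coeff (r - m)) (r+1),
    ← Finset.sum_range_reflect]
  refine Finset.sum_congr rfl fun m hm => ?_
  have : m ≤ r := by simpa [Nat.lt_succ_iff] using hm
  simp [mul_comm, Nat.sub_sub_self this]

lemma hval_h0 (r : ℕ) {n : ℕ} (lam : Fin n → ℕ) (hr : ∑ i, lam i = r) (p u v : Fin n → ℂ)
    (k : Fin n) :
    hval r lam (fun x => (-p x.1) ^ (r - (x.2 : ℕ))) u v k = ∏ i, (v i - u i * p k) ^ lam i := by
  rw [hval]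
  dsimp only
  rw [sum_rev_coeff r _ ((bprod_natDegree_le lam u v).trans hr.le)]
  simp only [bprod, Polynomial.eval_prod]
  refine Finset.prod_congr rfl fun i _ => ?_
  simp; ring

lemma hval_path (r : ℕ) {n : ℕ} (lam : Fin n → ℕ) (h0 g : Fin n × Fin (r+1) → ℂ) (ε : ℂ)
    (u v : Fin n → ℂ) (k : Fin n) :
    hval r lam (h0 + ε • g) u v k = hval r lam h0 u v k + ε * hval r lam g u v k := by
  simp [hval, add_mul, Finset.sum_add_distrib, Finset.mul_sum, mul_assoc]

lemma bprod_coeff_bound {n : ℕ} (lam : Fin n → ℕ) (u v : Fin n → ℂ) (j : ℕ) :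
    ‖(bprod lam u v).coeff j‖ ≤ ∏ i, (‖u i‖ + ‖v i‖) ^ lam i := by
  have hmul : ∀ (P Q : Polynomial ℂ) (P' Q' : Polynomial ℝ), (∀ j, ‖P.coeff j‖ ≤ P'.coeff j) →
      (∀ j, ‖Q.coeff j‖ ≤ Q'.coeff j) → ∀ j, ‖(P * Q).coeff j‖ ≤ (P' * Q').coeff j := by
    intro P Q P' Q' h1 h2 j
    rw [Polynomial.coeff_mul, Polynomial.coeff_mul]
    refine (norm_sum_le _ _).trans (Finset.sum_le_sum fun x _ => ?_)
    rw [norm_mul]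
    exact mul_le_mul (h1 _) (h2 _) (norm_nonneg _) ((norm_nonneg _).trans (h1 _))
  have hone : ∀ j, ‖(1 : Polynomial ℂ).coeff j‖ ≤ (1 : Polynomial ℝ).coeff j := by
    intro j; rw [Polynomial.coeff_one, Polynomial.coeff_one]; split_ifs <;> simp
  have hpow : ∀ (P : Polynomial ℂ) (P' : Polynomial ℝ), (∀ j, ‖P.coeff j‖ ≤ P'.coeff j) →
      ∀ m j, ‖(P ^ m).coeff j‖ ≤ (P' ^ m).coeff j := by
    intro P P' h m
    induction m with
    | zero => simpa using hone
    | succ m ih => rw [pow_succ, pow_succ]; exact hmul _ _ _ _ ih h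
  have hprod : ∀ (s : Finset (Fin n)) j,
      ‖(∏ i ∈ s, (Polynomial.C (u i) * Polynomial.X + Polynomial.C (v i)) ^ lam i).coeff j‖ ≤
      (∏ i ∈ s, (Polynomial.C ‖u i‖ * Polynomial.X + Polynomial.C ‖v i‖) ^ lam i).coeff j := by
    classical
    intro s
    induction s using Finset.induction_on with
    | empty => simpa using hone
    | insert i s hi ih =>
      rw [Finset.prod_insert hi, Finset.prod_insert hi]
      refine hmul _ _ _ _ (hpow _ _ (fun j => ?_) _) ih
      simp only [Polynomial.coeff_add, Polynomial.coeff_C_mul, Polynomial.coeff_X, Polynomial.coeff_C]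
      refine (norm_add_le _ _).trans ?_
      rw [norm_mul]
      split_ifs <;> simp
  refine (hprod Finset.univ j).trans ?_
  set Q := ∏ i, (Polynomial.C ‖u i‖ * Polynomial.X + Polynomial.C ‖v i‖) ^ lam i with hQ
  have hev : Q.eval 1 = ∏ i, (‖u i‖ + ‖v i‖) ^ lam i := by
    simp [hQ, Polynomial.eval_prod]
  rw [← hev, Polynomial.eval_eq_sum_range' (n := max (j+1) (Q.natDegree+1)) (by simp)]
  have := Finset.single_le_sum (f := fun i => Q.coeff i * 1 ^ i)
    (s := Finset.range (max (j+1) (Q.natDegree+1)))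
    (fun i _ => by simpa using (norm_nonneg _).trans (hprod Finset.univ i)) (a := j) (by simp)
  simpa using this

lemma hval_bound (r : ℕ) {n : ℕ} (lam : Fin n → ℕ) (g : Fin n × Fin (r+1) → ℂ) :
    ∃ K : ℝ, 0 ≤ K ∧ ∀ u v k, ‖hval r lam g u v k‖ ≤ K * ∏ i, (‖u i‖ + ‖v i‖) ^ lam i := by
  refine ⟨∑ x, ‖g x‖, Finset.sum_nonneg fun _ _ => norm_nonneg _, fun u v k => ?_⟩
  have hnn : 0 ≤ ∏ i, (‖u i‖ + ‖v i‖) ^ lam i := by positivity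
  refine (norm_sum_le _ _).trans ?_
  calc _ ≤ ∑ m, ‖g (k, m)‖ * ∏ i, (‖u i‖ + ‖v i‖) ^ lam i := by
        refine Finset.sum_le_sum fun m _ => ?_
        rw [norm_mul]
        exact mul_le_mul_of_nonneg_left (bprod_coeff_bound lam u v _) (norm_nonneg _)
    _ = (∑ m, ‖g (k, m)‖) * _ := by rw [Finset.sum_mul]
    _ ≤ _ := by
        refine mul_le_mul_of_nonneg_right ?_ hnn
        rw [Fintype.sum_prod_type]
        exact Finset.single_le_sum (f := fun k => ∑ m, ‖g (k, m)‖)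
          (fun _ _ => Finset.sum_nonneg fun _ _ => norm_nonneg _) (Finset.mem_univ k)

lemma hval_contDiff (r : ℕ) {n : ℕ} (lam : Fin n → ℕ) (g : Fin n × Fin (r+1) → ℂ) (k : Fin n) :
    ContDiff ℂ 1 (fun z : Fin n → ℂ => hval r lam g 1 z k) := by
  have : (fun z : Fin n → ℂ => hval r lam g 1 z k) =
      fun z => eval z (hval r lam (fun x => C (g x)) 1 X k : MvPolynomial (Fin n) ℂ) := by
    ext z
    rw [hval_map]
    congr 1 <;> ext <;> simp
  rw [this]
  exact (AnalyticOnNhd.eval_mvPolynomial _).contDiff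

open Filter Topology in
lemma path_near (r : ℕ) {n : ℕ} (lam : Fin n → ℕ) (hr : ∑ i, lam i = r)
    (g : Fin n × Fin (r+1) → ℂ) (η : ℝ) (hη : 0 < η) :
    ∀ᶠ ε in 𝓝 (0 : ℂ), ∀ u v : Fin n → ℂ, (∀ i, u i ≠ 0 ∨ v i ≠ 0) →
      (∀ k, hval r lam ((fun x => (-((x.1 : ℕ) : ℂ)) ^ (r - (x.2 : ℕ))) + ε • g) u v k = 0) →
      ∃ τ : Equiv.Perm (Fin n), ∀ i, u i ≠ 0 ∧ ‖v i / u i - ((τ i : ℕ) : ℂ)‖ < η := by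
  obtain ⟨K, hK, hbound⟩ := hval_bound r lam g
  set η' := min η (1/2) with hη'
  have hη'0 : 0 < η' := by positivity
  have hη'1 : η' ≤ 1/2 := min_le_right _ _
  set θ := η' / (2 * n + 2) with hθ
  have hn0 : (0:ℝ) ≤ n := Nat.cast_nonneg n
  have hθ0 : 0 < θ := by positivity
  have hθη : θ * (2 * n + 2) = η' := by rw [hθ]; field_simp
  have hθ1 : θ ≤ 1/2 := by nlinarith
  have hsmall : ∀ᶠ ε in 𝓝 (0 : ℂ), ‖ε‖ * K < θ ^ r := by
    have : Tendsto (fun ε : ℂ => ‖ε‖ * K) (𝓝 0) (𝓝 0) := by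
      have : Continuous (fun ε : ℂ => ‖ε‖ * K) := by fun_prop
      simpa using this.tendsto 0
    exact this.eventually_lt_const (pow_pos hθ0 _)
  filter_upwards [hsmall] with ε hε u v huv hsol
  have hpos : ∀ i, 0 < ‖u i‖ + ‖v i‖ := by
    intro i
    rcases huv i with h | h
    · have := norm_pos_iff.2 h; positivity
    · have := norm_pos_iff.2 h; positivity
  have hex : ∀ k : Fin n, ∃ i, ‖v i - u i * ((k : ℕ) : ℂ)‖ < θ * (‖u i‖ + ‖v i‖) := by
    intro k
    by_contra! hcon
    have h1 := hsol k
    rw [hval_path, hval_h0 r lam hr (fun k => ((k : ℕ) : ℂ))] at h1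
    have h2 : ‖∏ i, (v i - u i * ((k : ℕ) : ℂ)) ^ lam i‖ = ‖ε‖ * ‖hval r lam g u v k‖ := by
      rw [← norm_mul, ← norm_neg (ε * _)]; congr 1; linear_combination h1
    have hP : 0 < ∏ i, (‖u i‖ + ‖v i‖) ^ lam i := Finset.prod_pos fun i _ => pow_pos (hpos i) _
    have h3 : θ ^ r * ∏ i, (‖u i‖ + ‖v i‖) ^ lam i ≤ ‖∏ i, (v i - u i * ((k : ℕ) : ℂ)) ^ lam i‖ := by
      rw [← hr, ← Finset.prod_pow_eq_pow_sum, ← Finset.prod_mul_distrib, norm_prod]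
      refine Finset.prod_le_prod (fun i _ => by have := hpos i; positivity) fun i _ => ?_
      rw [← mul_pow, norm_pow]
      exact pow_le_pow_left₀ (by have := hpos i; positivity) (hcon i) _
    have h4 := mul_le_mul_of_nonneg_left (hbound u v k) (norm_nonneg ε)
    have h5 := mul_lt_mul_of_pos_right hε hP
    nlinarith
  have hnear : ∀ i (k : Fin n), ‖v i - u i * ((k : ℕ) : ℂ)‖ < θ * (‖u i‖ + ‖v i‖) →
      u i ≠ 0 ∧ ‖v i / u i - ((k : ℕ) : ℂ)‖ < η' := by
    intro i k h
    have hu : u i ≠ 0 := by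
      intro h0
      have := hpos i
      rw [h0] at h this
      simp at h this
      have := norm_pos_iff.2 this
      nlinarith
    refine ⟨hu, ?_⟩
    have hup := norm_pos_iff.2 hu
    set z := v i / u i with hz
    have hvz : v i = u i * z := by rw [hz]; field_simp
    rw [hvz, ← mul_sub, norm_mul, norm_mul] at h
    have h1 : ‖z - ((k : ℕ) : ℂ)‖ < θ * (1 + ‖z‖) := by
      by_contra! hc
      have := mul_le_mul_of_nonneg_left hc hup.le
      nlinarith
    have hk : ‖((k : ℕ) : ℂ)‖ ≤ n := by
      rw [Complex.norm_natCast]; exact_mod_cast k.2.le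
    have h2 : ‖z‖ ≤ ‖z - ((k : ℕ) : ℂ)‖ + ‖((k : ℕ) : ℂ)‖ := by
      simpa using norm_add_le (z - ((k : ℕ) : ℂ)) ((k : ℕ) : ℂ)
    have h3 : ‖z‖ ≤ 2 * n + 1 := by nlinarith [norm_nonneg z]
    calc _ < θ * (1 + ‖z‖) := h1
      _ ≤ θ * (2 * n + 2) := by nlinarith
      _ = η' := hθη
  choose f hf using hex
  have hinj : Function.Injective f := by
    intro k k' hkk
    have h1 := (hnear _ _ (hf k)).2
    have h2 := (hnear _ _ (hf k')).2
    rw [← hkk] at h2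
    have h3 : ‖((k : ℕ) : ℂ) - ((k' : ℕ) : ℂ)‖ < 1 := by
      have := norm_sub_le (v (f k) / u (f k) - ((k' : ℕ) : ℂ)) (v (f k) / u (f k) - ((k : ℕ) : ℂ))
      rw [sub_sub_sub_cancel_left] at this
      linarith
    have h4 : |((k : ℕ) : ℤ) - ((k' : ℕ) : ℤ)| < 1 := by
      have : ‖(((((k : ℕ) : ℤ) - ((k' : ℕ) : ℤ)) : ℤ) : ℂ)‖ < 1 := by push_cast; exact h3
      rw [Complex.norm_intCast] at this
      exact_mod_cast this
    rw [Int.abs_lt_one_iff] at h4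
    apply Fin.ext; omega
  have hbij := Finite.injective_iff_bijective.1 hinj
  refine ⟨(Equiv.ofBijective f hbij).symm, fun i => ?_⟩
  obtain ⟨k, rfl⟩ := hbij.2 i
  have : (Equiv.ofBijective f hbij).symm (f k) = k := Equiv.ofBijective_symm_apply_apply _ _ _
  rw [this]
  have h := hnear _ _ (hf k)
  exact ⟨h.1, h.2.trans_le (min_le_left _ _)⟩

open Filter Topology in
lemma path_count (r : ℕ) {n : ℕ} (lam : Fin n → ℕ) (hlam : ∀ i, 1 ≤ lam i) (hr : ∑ i, lam i = r)
    (g : Fin n × Fin (r+1) → ℂ)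
    (hg : ∀ (τ : Equiv.Perm (Fin n)) k, hval r lam g 1 (fun i => ((τ i : ℕ) : ℂ)) k ≠ 0) :
    ∀ᶠ ε in 𝓝[≠] (0 : ℂ),
      {z : Fin n → ℂ | ∀ k,
        hval r lam ((fun x => (-((x.1 : ℕ) : ℂ)) ^ (r - (x.2 : ℕ))) + ε • g) 1 z k = 0}.encard
      = ((n.factorial * ∏ i, lam i : ℕ) : ℕ∞) := by
  classical
  let p : Fin n → ℂ := fun k => ((k : ℕ) : ℂ)
  have hp : Function.Injective p := fun a b h => Fin.ext (Nat.cast_injective (R := ℂ) h)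
  have hp1 : ∀ a b, dist (p a) (p b) < 1 → a = b := by
    intro k k' h3
    rw [dist_eq_norm] at h3
    have h4 : |((k : ℕ) : ℤ) - ((k' : ℕ) : ℤ)| < 1 := by
      have : ‖(((((k : ℕ) : ℤ) - ((k' : ℕ) : ℤ)) : ℤ) : ℂ)‖ < 1 := by push_cast; exact h3
      rw [Complex.norm_intCast] at this
      exact_mod_cast this
    rw [Int.abs_lt_one_iff] at h4
    apply Fin.ext; omega
  choose W hWo hWm hWU hWc using fun τ : Equiv.Perm (Fin n) =>
    local_count lam hlam p hp (fun k z => hval r lam g 1 z k) (hval_contDiff r lam g) τ (hg τ)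
      (Metric.ball (p ∘ τ) (1/2)) Metric.isOpen_ball (by simp)
  have hηex : ∃ η > 0, ∀ τ : Equiv.Perm (Fin n), Metric.ball (p ∘ τ) η ⊆ W τ := by
    choose δ hδ hδW using fun τ : Equiv.Perm (Fin n) => Metric.isOpen_iff.1 (hWo τ) _ (hWm τ)
    refine ⟨Finset.univ.inf' Finset.univ_nonempty δ, ?_, fun τ => ?_⟩
    · simpa using hδ
    · exact (Metric.ball_subset_ball (Finset.inf'_le _ (Finset.mem_univ τ))).trans (hδW τ)
  obtain ⟨η, hη, hηW⟩ := hηex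
  filter_upwards [eventually_all.2 hWc, nhdsWithin_le_nhds (path_near r lam hr g η hη)] with ε hε hnear
  set Z := {z : Fin n → ℂ | ∀ k,
        hval r lam ((fun x => (-((x.1 : ℕ) : ℂ)) ^ (r - (x.2 : ℕ))) + ε • g) 1 z k = 0} with hZ
  let S : Equiv.Perm (Fin n) → Set (Fin n → ℂ) := fun τ =>
    {z | z ∈ W τ ∧ ∀ k, ∏ i, (z i - p k) ^ lam i + ε * hval r lam g 1 z k = 0}
  have hmem : ∀ z, z ∈ Z ↔ ∀ k, ∏ i, (z i - p k) ^ lam i + ε * hval r lam g 1 z k = 0 := by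
    intro z
    refine forall_congr' fun k => ?_
    rw [hval_path, hval_h0 r lam hr p]
    simp
  have hZS : Z = ⋃ τ, S τ := by
    ext z
    rw [Set.mem_iUnion]
    constructor
    · intro hz
      obtain ⟨τ, hτ⟩ := hnear 1 z (by simp) hz
      refine ⟨τ, hηW τ ?_, (hmem z).1 hz⟩
      rw [Metric.mem_ball, dist_pi_lt_iff hη]
      intro i
      simpa [dist_eq_norm] using (hτ i).2
    · rintro ⟨τ, -, hz⟩
      exact (hmem z).2 hz
  have hpos : 0 < ∏ i, lam i := Finset.prod_pos fun i _ => hlam i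
  have hfin : ∀ τ, (S τ).Finite := fun τ => Set.finite_of_ncard_pos (by
    rw [show (S τ).ncard = _ from hε τ]; exact hpos)
  have hdisj : Pairwise (Function.onFun Disjoint S) := by
    intro τ τ' hne
    rw [Function.onFun, Set.disjoint_left]
    intro z hz hz'
    apply hne
    have h1 := hWU τ hz.1
    have h2 := hWU τ' hz'.1
    ext i : 1
    apply hp1
    rw [Metric.mem_ball, dist_pi_lt_iff (by norm_num)] at h1 h2
    have h1 := h1 i
    have h2 := h2 i
    have := dist_triangle_left (p (τ i)) (p (τ' i)) (z i)
    simp only [Function.comp] at h1 h2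
    linarith
  rw [hZS, Set.encard_iUnion_of_finite hdisj, finsum_eq_sum_of_fintype]
  have : ∀ τ, (S τ).encard = ((∏ i, lam i : ℕ) : ℕ∞) := fun τ => by
    rw [← (hfin τ).cast_ncard_eq, show (S τ).ncard = _ from hε τ]
  simp [this, Fintype.card_perm]

/-- nullstellensatz over a fibre -/
lemma mem_image_iff_fibre {ι κ J : Type} [Finite ι] [Finite κ]
    (f : J → MvPolynomial κ (MvPolynomial ι ℂ)) (q : MvPolynomial κ (MvPolynomial ι ℂ))
    (h : ι → ℂ) (x : PrimeSpectrum (MvPolynomial ι ℂ)) (hx : x.asIdeal = RingHom.ker (eval h)) :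
    x ∈ PrimeSpectrum.comap (C : MvPolynomial ι ℂ →+* MvPolynomial κ (MvPolynomial ι ℂ)) ''
      (PrimeSpectrum.zeroLocus (Set.range f) \ PrimeSpectrum.zeroLocus {q}) ↔
    ∃ z : κ → ℂ, (∀ j, eval₂Hom (eval h) z (f j) = 0) ∧ eval₂Hom (eval h) z q ≠ 0 := by
  constructor
  · rintro ⟨Q, ⟨hQf, hQq⟩, hQx⟩
    have hQx' : Q.asIdeal.comap (C : MvPolynomial ι ℂ →+* _) = RingHom.ker (eval h) := by
      rw [← hx, ← hQx]; rfl
    let φ : MvPolynomial κ (MvPolynomial ι ℂ) →+* MvPolynomial κ ℂ := map (eval h)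
    have hφ : Function.Surjective φ := map_surjective _ (fun c => ⟨C c, by simp⟩)
    have hker : RingHom.ker φ ≤ Q.asIdeal := by
      rw [ker_map, Ideal.map_le_iff_le_comap, hQx']
    have hprime : (Q.asIdeal.map φ).IsPrime := Ideal.map_isPrime_of_surjective hφ hker
    have hq : φ q ∉ Q.asIdeal.map φ := by
      intro hq
      apply hQq
      have : q ∈ (Q.asIdeal.map φ).comap φ := hq
      rw [Ideal.comap_map_of_surjective' φ hφ, sup_eq_left.2 hker] at this
      simpa [PrimeSpectrum.mem_zeroLocus] using this
    rw [← MvPolynomial.IsPrime.vanishingIdeal_zeroLocus (K := ℂ) (Q.asIdeal.map φ),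
      mem_vanishingIdeal_iff] at hq
    push Not at hq
    obtain ⟨z, hz, hzq⟩ := hq
    have hev : ∀ p, eval₂Hom (eval h) z p = aeval z (φ p) := fun p => by
      rw [coe_eval₂Hom, eval₂_eq_eval_map, aeval_eq_eval]
    refine ⟨z, fun j => ?_, ?_⟩
    · have := hz (φ (f j)) (Ideal.mem_map_of_mem _ (hQf ⟨j, rfl⟩))
      rwa [hev]
    · rwa [hev]
  · rintro ⟨z, hz, hq⟩
    refine ⟨⟨RingHom.ker (eval₂Hom (eval h) z), RingHom.ker_isPrime _⟩, ⟨?_, ?_⟩, ?_⟩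
    · rintro _ ⟨j, rfl⟩
      exact hz j
    · simpa [PrimeSpectrum.mem_zeroLocus, RingHom.mem_ker] using hq
    · ext p
      simp only [hx, PrimeSpectrum.comap_asIdeal, Ideal.mem_comap, RingHom.mem_ker]
      simp

/-- dichotomy: an existential condition holds generically or fails generically. -/
lemma generic_dichotomy {ι κ J : Type} [Finite ι] [Finite κ] [Finite J]
    (f : J → MvPolynomial κ (MvPolynomial ι ℂ)) (q : MvPolynomial κ (MvPolynomial ι ℂ)) :
    ∃ P : MvPolynomial ι ℂ, P ≠ 0 ∧
      ((∀ h, eval h P ≠ 0 →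
        ∃ z : κ → ℂ, (∀ j, eval₂Hom (eval h) z (f j) = 0) ∧ eval₂Hom (eval h) z q ≠ 0) ∨
       (∀ h, eval h P ≠ 0 →
        ¬ ∃ z : κ → ℂ, (∀ j, eval₂Hom (eval h) z (f j) = 0) ∧ eval₂Hom (eval h) z q ≠ 0)) := by
  classical
  have hfp : (C : MvPolynomial ι ℂ →+* MvPolynomial κ (MvPolynomial ι ℂ)).FinitePresentation := by
    rw [← MvPolynomial.algebraMap_eq, RingHom.finitePresentation_algebraMap]
    exact (inferInstance : Algebra.FinitePresentation (MvPolynomial ι ℂ) (MvPolynomial κ (MvPolynomial ι ℂ)))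
  have hcons : Topology.IsConstructible
      (PrimeSpectrum.zeroLocus (Set.range f) \ PrimeSpectrum.zeroLocus {q}) := by
    rw [← PrimeSpectrum.exists_constructibleSetData_iff]
    obtain ⟨m, ⟨e⟩⟩ := Finite.exists_equiv_fin J
    refine ⟨{⟨q, m, f ∘ e.symm⟩}, ?_⟩
    simp [PrimeSpectrum.ConstructibleSetData.toSet, PrimeSpectrum.BasicConstructibleSetData.toSet]
  obtain ⟨S, hS⟩ := PrimeSpectrum.exists_constructibleSetData_iff.2
    (PrimeSpectrum.isConstructible_comap_image hfp hcons)
  have key : ∀ h : ι → ℂ,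
      (∃ D ∈ S, (∀ i, eval h (D.g i) = 0) ∧ eval h D.f ≠ 0) ↔
      ∃ z : κ → ℂ, (∀ j, eval₂Hom (eval h) z (f j) = 0) ∧ eval₂Hom (eval h) z q ≠ 0 := by
    intro h
    rw [← mem_image_iff_fibre f q h ⟨RingHom.ker (eval h), RingHom.ker_isPrime _⟩ rfl, ← hS]
    simp [PrimeSpectrum.ConstructibleSetData.toSet, PrimeSpectrum.BasicConstructibleSetData.toSet,
      PrimeSpectrum.mem_zeroLocus, Set.range_subset_iff, RingHom.mem_ker]
    tauto
  by_cases hD : ∃ D ∈ S, (∀ i, D.g i = 0) ∧ D.f ≠ 0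
  · obtain ⟨D, hDS, hDg, hDf⟩ := hD
    exact ⟨D.f, hDf, Or.inl fun h hh => (key h).1 ⟨D, hDS, fun i => by simp [hDg i], hh⟩⟩
  · push Not at hD
    have : ∀ D ∈ S, ∃ p : MvPolynomial ι ℂ, p ≠ 0 ∧
        ∀ h, eval h p ≠ 0 → ¬ ((∀ i, eval h (D.g i) = 0) ∧ eval h D.f ≠ 0) := by
      intro D hDS
      by_cases hg : ∀ i, D.g i = 0
      · exact ⟨1, one_ne_zero, fun h _ H => H.2 (by simp [hD D hDS hg])⟩
      · push Not at hg
        obtain ⟨i, hi⟩ := hg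
        exact ⟨D.g i, hi, fun h hh H => hh (H.1 i)⟩
    choose! p hp0 hp using this
    refine ⟨∏ D ∈ S, p D, Finset.prod_ne_zero_iff.2 hp0, Or.inr fun h hh => ?_⟩
    rw [← key]
    rintro ⟨D, hDS, H⟩
    rw [map_prod, Finset.prod_ne_zero_iff] at hh
    exact hp D hDS h (hh D hDS) H


lemma le_encard_iff_exists {α : Type} (Z : Set α) (d : ℕ) :
    (∃ s : Fin d → α, Function.Injective s ∧ ∀ j, s j ∈ Z) ↔ (d : ℕ∞) ≤ Z.encard := by
  constructor
  · rintro ⟨s, hs, hm⟩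
    have h1 : Set.range s ⊆ Z := by rintro _ ⟨j, rfl⟩; exact hm j
    refine le_trans ?_ (Set.encard_le_encard h1)
    rw [← Set.image_univ, hs.encard_image]
    simp
  · intro h
    obtain ⟨t, ht, hd⟩ := Set.exists_subset_encard_eq h
    have hfin : t.Finite := Set.finite_of_encard_eq_coe hd
    have hn : Nat.card t = d := by
      rw [Nat.card_coe_set_eq, Set.ncard, hd]; rfl
    have := hfin.to_subtype
    let e := (Finite.equivFinOfCardEq hn).symm
    exact ⟨fun j => e j, Subtype.val_injective.comp e.injective, fun j => ht (e j).2⟩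

/-- `Q` holds generically or fails generically. -/
def GenDich {ι : Type} (Q : (ι → ℂ) → Prop) : Prop :=
  ∃ P : MvPolynomial ι ℂ, P ≠ 0 ∧
    ((∀ h, eval h P ≠ 0 → Q h) ∨ (∀ h, eval h P ≠ 0 → ¬ Q h))

lemma genDich_count (r : ℕ) {n : ℕ} (lam : Fin n → ℕ) (d : ℕ) :
    GenDich (fun h : Fin n × Fin (r+1) → ℂ => ∃ s : Fin d → Fin n → ℂ, Function.Injective s ∧
      ∀ j, s j ∈ {z : Fin n → ℂ | ∀ k, hval r lam h 1 z k = 0}) := by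
  classical
  let κ := (Fin d × Fin n) ⊕ (Fin d × Fin d × Fin n)
  let A := MvPolynomial (Fin n × Fin (r+1)) ℂ
  let f : Fin d × Fin n → MvPolynomial κ A := fun x =>
    hval r lam (fun y => C (X y)) 1 (fun i => X (Sum.inl (x.1, i))) x.2
  let q : MvPolynomial κ A := ∏ a : Fin d, ∏ b ∈ Finset.univ.erase a,
    ∑ i, X (Sum.inr (a, b, i)) * (X (Sum.inl (a, i)) - X (Sum.inl (b, i)))
  obtain ⟨P, hP, hdich⟩ := generic_dichotomy f q
  have key : ∀ h : Fin n × Fin (r+1) → ℂ,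
      (∃ z : κ → ℂ, (∀ j, eval₂Hom (eval h) z (f j) = 0) ∧ eval₂Hom (eval h) z q ≠ 0) ↔
      ∃ s : Fin d → Fin n → ℂ, Function.Injective s ∧
      ∀ j, s j ∈ {z : Fin n → ℂ | ∀ k, hval r lam h 1 z k = 0} := by
    intro h
    have hf : ∀ (z : κ → ℂ) j k, eval₂Hom (eval h) z (f (j, k)) =
        hval r lam h 1 (fun i => z (Sum.inl (j, i))) k := by
      intro z j k
      rw [hval_map]
      congr 1 <;> ext <;> simp
    have hq : ∀ (z : κ → ℂ), eval₂Hom (eval h) z q =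
        ∏ a : Fin d, ∏ b ∈ Finset.univ.erase a,
          ∑ i, z (Sum.inr (a, b, i)) * (z (Sum.inl (a, i)) - z (Sum.inl (b, i))) := by
      intro z
      simp [q, map_prod, map_sum]
    constructor
    · rintro ⟨z, h1, h2⟩
      refine ⟨fun j i => z (Sum.inl (j, i)), ?_, fun j k => ?_⟩
      · intro a b hab
        by_contra hne
        rw [hq, Finset.prod_ne_zero_iff] at h2
        have h3 := h2 a (Finset.mem_univ _)
        rw [Finset.prod_ne_zero_iff] at h3
        apply h3 b (Finset.mem_erase.2 ⟨Ne.symm hne, Finset.mem_univ _⟩)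
        refine Finset.sum_eq_zero fun i _ => ?_
        have := congrFun hab i
        simp only at this
        rw [this, sub_self, mul_zero]
      · rw [← hf]; exact h1 (j, k)
    · rintro ⟨s, hs, hm⟩
      have hsep : ∀ a b : Fin d, ∃ w : Fin n → ℂ, a ≠ b → ∑ i, w i * (s a i - s b i) ≠ 0 := by
        intro a b
        by_cases hab : a = b
        · exact ⟨0, fun h => absurd hab h⟩
        · obtain ⟨i, hi⟩ := Function.ne_iff.1 (hs.ne hab)
          refine ⟨Pi.single i 1, fun _ => ?_⟩
          rw [Finset.sum_eq_single i]
          · simpa using sub_ne_zero.2 hi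
          · intro j _ hj; simp [Pi.single_eq_of_ne hj]
          · simp
      choose w hw using hsep
      refine ⟨Sum.elim (fun x => s x.1 x.2) (fun x => w x.1 x.2.1 x.2.2), ?_, ?_⟩
      · rintro ⟨j, k⟩
        rw [hf]; exact hm j k
      · rw [hq]
        refine Finset.prod_ne_zero_iff.2 fun a _ => Finset.prod_ne_zero_iff.2 fun b hb => ?_
        exact hw a b (Finset.ne_of_mem_erase hb).symm
  refine ⟨P, hP, ?_⟩
  simp only [key] at hdich
  exact hdich

/-- the product detecting points at infinity and coinciding points -/
def badProd {R : Type} [CommRing R] {n : ℕ} (u v : Fin n → R) : R :=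
  (∏ i, u i) * ∏ i, ∏ j ∈ Finset.univ.erase i, (u i * v j - u j * v i)

lemma badProd_map {R S : Type} [CommRing R] [CommRing S] (φ : R →+* S) {n : ℕ} (u v : Fin n → R) :
    φ (badProd u v) = badProd (φ ∘ u) (φ ∘ v) := by
  simp [badProd, map_prod]

lemma genDich_bad (r : ℕ) {n : ℕ} (lam : Fin n → ℕ) :
    GenDich (fun h : Fin n × Fin (r+1) → ℂ => ∃ u v : Fin n → ℂ, (∀ i, u i ≠ 0 ∨ v i ≠ 0) ∧
      (∀ k, hval r lam h u v k = 0) ∧ badProd u v = 0) := by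
  classical
  let κ := (Fin n ⊕ Fin n) ⊕ (Fin n ⊕ Fin n)
  let A := MvPolynomial (Fin n × Fin (r+1)) ℂ
  let f : Option (Fin n) → MvPolynomial κ A := fun x => match x with
    | some k => hval r lam (fun y => C (X y)) (fun i => X (Sum.inl (Sum.inl i)))
        (fun i => X (Sum.inl (Sum.inr i))) k
    | none => badProd (fun i => X (Sum.inl (Sum.inl i))) (fun i => X (Sum.inl (Sum.inr i)))
  let q : MvPolynomial κ A := ∏ i, (X (Sum.inr (Sum.inl i)) * X (Sum.inl (Sum.inl i)) +
    X (Sum.inr (Sum.inr i)) * X (Sum.inl (Sum.inr i)))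
  obtain ⟨P, hP, hdich⟩ := generic_dichotomy f q
  have key : ∀ h : Fin n × Fin (r+1) → ℂ,
      (∃ z : κ → ℂ, (∀ j, eval₂Hom (eval h) z (f j) = 0) ∧ eval₂Hom (eval h) z q ≠ 0) ↔
      ∃ u v : Fin n → ℂ, (∀ i, u i ≠ 0 ∨ v i ≠ 0) ∧
      (∀ k, hval r lam h u v k = 0) ∧ badProd u v = 0 := by
    intro h
    have hf1 : ∀ (z : κ → ℂ) k, eval₂Hom (eval h) z (f (some k)) =
        hval r lam h (fun i => z (Sum.inl (Sum.inl i))) (fun i => z (Sum.inl (Sum.inr i))) k := by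
      intro z k
      simp only [f]
      rw [hval_map]
      congr 1 <;> ext <;> simp
    have hf2 : ∀ (z : κ → ℂ), eval₂Hom (eval h) z (f none) =
        badProd (fun i => z (Sum.inl (Sum.inl i))) (fun i => z (Sum.inl (Sum.inr i))) := by
      intro z
      simp only [f]
      rw [badProd_map]
      congr 1 <;> ext <;> simp
    have hq : ∀ (z : κ → ℂ), eval₂Hom (eval h) z q =
        ∏ i, (z (Sum.inr (Sum.inl i)) * z (Sum.inl (Sum.inl i)) +
          z (Sum.inr (Sum.inr i)) * z (Sum.inl (Sum.inr i))) := by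
      intro z
      simp [q, map_prod]
    constructor
    · rintro ⟨z, h1, h2⟩
      have g1 : ∀ k, hval r lam h (fun i => z (Sum.inl (Sum.inl i)))
          (fun i => z (Sum.inl (Sum.inr i))) k = 0 := by
        intro k; rw [← hf1]; exact h1 (some k)
      have g2 : badProd (fun i => z (Sum.inl (Sum.inl i)))
          (fun i => z (Sum.inl (Sum.inr i))) = 0 := by
        rw [← hf2]; exact h1 none
      refine ⟨fun i => z (Sum.inl (Sum.inl i)), fun i => z (Sum.inl (Sum.inr i)),
        fun i => ?_, g1, g2⟩
      rw [hq, Finset.prod_ne_zero_iff] at h2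
      have h3 := h2 i (Finset.mem_univ i)
      by_contra! hc
      apply h3
      rw [hc.1, hc.2]; simp
    · rintro ⟨u, v, h1, h2, h3⟩
      refine ⟨Sum.elim (Sum.elim u v)
        (Sum.elim (fun i => if u i = 0 then 0 else 1) (fun i => if u i = 0 then 1 else 0)), ?_, ?_⟩
      · rintro (_ | k)
        · rw [hf2]; exact h3
        · rw [hf1]; exact h2 k
      · rw [hq]
        refine Finset.prod_ne_zero_iff.2 fun i _ => ?_
        rcases eq_or_ne (u i) 0 with h0 | h0
        · have := (h1 i).resolve_left (by simpa using h0)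
          simpa [h0] using this
        · simpa [h0] using h0
  refine ⟨P, hP, ?_⟩
  simp only [key] at hdich
  exact hdich

lemma bprod_one_monic {R : Type} [CommRing R] {n : ℕ} (lam : Fin n → ℕ) (v : Fin n → R) :
    (bprod lam 1 v).Monic := by
  refine Polynomial.monic_prod_of_monic _ _ fun i _ => ?_
  simpa using (Polynomial.monic_X_add_C (v i)).pow (lam i)

lemma bprod_one_coeff (r : ℕ) {n : ℕ} (lam : Fin n → ℕ) (hr : ∑ i, lam i = r) (v : Fin n → ℂ) :
    (bprod lam 1 v).coeff r = 1 := by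
  have h1 : (bprod lam 1 v).natDegree = r := by
    rw [bprod, Polynomial.natDegree_prod_of_monic, ← hr]
    · refine Finset.sum_congr rfl fun i _ => ?_
      rw [Polynomial.natDegree_pow]
      simp
    · intro i _
      simpa using (Polynomial.monic_X_add_C (v i)).pow (lam i)
  have h2 := bprod_one_monic lam v
  rw [Polynomial.Monic, Polynomial.leadingCoeff, h1] at h2
  exact h2

lemma exists_eval_ne {ι : Type} [Finite ι] (P : MvPolynomial ι ℂ) (hP : P ≠ 0) :
    ∃ h, eval h P ≠ 0 := by
  by_contra! hc
  exact hP (MvPolynomial.funext fun x => by simpa using hc x)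

open Filter Topology in
lemma eventually_eval_ne {ι : Type} [Finite ι] (P : MvPolynomial ι ℂ) (h0 g : ι → ℂ)
    (h1 : eval (h0 + g) P ≠ 0) : ∀ᶠ ε in 𝓝[≠] (0 : ℂ), eval (h0 + ε • g) P ≠ 0 := by
  let p : Polynomial ℂ :=
    aeval (fun x => Polynomial.C (h0 x) + Polynomial.X * Polynomial.C (g x)) P
  have hp : ∀ ε, p.eval ε = eval (h0 + ε • g) P := by
    intro ε
    have : (Polynomial.evalRingHom ε).comp (aeval (R := ℂ)
      (fun x => Polynomial.C (h0 x) + Polynomial.X * Polynomial.C (g x))).toRingHom =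
        eval (h0 + ε • g) := by
      apply MvPolynomial.ringHom_ext
      · intro a; simp
      · intro i; simp; exact mul_comm _ _
    exact DFunLike.congr_fun this P
  have hp0 : p ≠ 0 := by
    intro h
    apply h1
    have := hp 1
    rw [h, one_smul] at this
    rw [← this]; simp
  have hfin : (p.rootSet ℂ \ {0}).Finite := (Polynomial.rootSet_finite p ℂ).sdiff
  have hmem : (p.rootSet ℂ \ {0})ᶜ ∈ 𝓝 (0 : ℂ) := hfin.isClosed.isOpen_compl.mem_nhds (by simp)
  rw [eventually_nhdsWithin_iff]
  filter_upwards [hmem] with ε hε hne hz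
  apply hε
  refine ⟨?_, hne⟩
  rw [Polynomial.mem_rootSet]
  refine ⟨hp0, ?_⟩
  rw [Polynomial.coe_aeval_eq_eval, hp, hz]

lemma hval_one_poly_ne (r : ℕ) {n : ℕ} (lam : Fin n → ℕ) (hr : ∑ i, lam i = r)
    (z : Fin n → ℂ) (k : Fin n) :
    ∃ L : MvPolynomial (Fin n × Fin (r+1)) ℂ, L ≠ 0 ∧ ∀ h, eval h L = hval r lam h 1 z k := by
  classical
  refine ⟨∑ m : Fin (r+1), X (k, m) * C ((bprod lam 1 z).coeff (r - m)), ?_, ?_⟩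
  · intro h
    have := congrArg (eval (fun x : Fin n × Fin (r+1) => if x = (k, 0) then (1:ℂ) else 0)) h
    rw [map_sum, Finset.sum_eq_single (0 : Fin (r+1))] at this
    · simp [bprod_one_coeff r lam hr] at this
    · intro b _ hb
      simp [hb]
    · simp
  · intro h
    simp [hval]

open Filter Topology in
theorem generic_count (r : ℕ) {n : ℕ} (lam : Fin n → ℕ) (hlam : ∀ i, 1 ≤ lam i)
    (hr : ∑ i, lam i = r) :
    ∃ P : MvPolynomial (Fin n × Fin (r+1)) ℂ, P ≠ 0 ∧ ∀ h, eval h P ≠ 0 →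
      {z : Fin n → ℂ | ∀ k, hval r lam h 1 z k = 0}.encard
        = ((n.factorial * ∏ i, lam i : ℕ) : ℕ∞) ∧
      ∀ u v : Fin n → ℂ, (∀ i, u i ≠ 0 ∨ v i ≠ 0) → (∀ k, hval r lam h u v k = 0) →
        badProd u v ≠ 0 := by
  classical
  set N := n.factorial * ∏ i, lam i with hN
  obtain ⟨P1, hP1, hd1⟩ := genDich_count r lam N
  obtain ⟨P2, hP2, hd2⟩ := genDich_count r lam (N+1)
  obtain ⟨P3, hP3, hd3⟩ := genDich_bad r lam
  have hlin : ∀ (τ : Equiv.Perm (Fin n)) (k : Fin n), ∃ L : MvPolynomial (Fin n × Fin (r+1)) ℂ,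
      L ≠ 0 ∧ ∀ h, eval h L = hval r lam h 1 (fun i => ((τ i : ℕ) : ℂ)) k :=
    fun τ k => hval_one_poly_ne r lam hr _ k
  choose L hL0 hL using hlin
  set P := P1 * P2 * P3 with hPdef
  have hP : P ≠ 0 := mul_ne_zero (mul_ne_zero hP1 hP2) hP3
  obtain ⟨hs, hhs⟩ := exists_eval_ne (P * ∏ τ, ∏ k, L τ k) (mul_ne_zero hP
    (Finset.prod_ne_zero_iff.2 fun τ _ => Finset.prod_ne_zero_iff.2 fun k _ => hL0 τ k))
  rw [map_mul, map_prod] at hhs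
  have hsP : eval hs P ≠ 0 := left_ne_zero_of_mul hhs
  have hsL : ∀ (τ : Equiv.Perm (Fin n)) k, hval r lam hs 1 (fun i => ((τ i : ℕ) : ℂ)) k ≠ 0 := by
    intro τ k
    have := Finset.prod_ne_zero_iff.1 (right_ne_zero_of_mul hhs) τ (Finset.mem_univ _)
    rw [map_prod] at this
    rw [← hL]
    exact Finset.prod_ne_zero_iff.1 this k (Finset.mem_univ _)
  let h0 : Fin n × Fin (r+1) → ℂ := fun x => (-((x.1 : ℕ) : ℂ)) ^ (r - (x.2 : ℕ))
  let g := hs - h0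
  have hg : ∀ (τ : Equiv.Perm (Fin n)) k, hval r lam g 1 (fun i => ((τ i : ℕ) : ℂ)) k ≠ 0 := by
    intro τ k
    have e1 := hval_path r lam h0 g 1 1 (fun i => ((τ i : ℕ) : ℂ)) k
    have e2 : h0 + (1:ℂ) • g = hs := by simp [g]
    have e3 : hval r lam h0 1 (fun i => ((τ i : ℕ) : ℂ)) k = 0 := by
      have := hval_h0 r lam hr (fun k => ((k : ℕ) : ℂ)) 1 (fun i => ((τ i : ℕ) : ℂ)) k
      refine this.trans ?_
      refine Finset.prod_eq_zero (Finset.mem_univ (τ.symm k)) ?_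
      have := hlam (τ.symm k)
      rw [pow_eq_zero_iff (by omega)]
      simp
    rw [e2, e3, zero_add, one_mul] at e1
    rw [← e1]
    exact hsL τ k
  have hcount := path_count r lam hlam hr g hg
  have hnear := (path_near r lam hr g (1/2) (by norm_num)).filter_mono
    (nhdsWithin_le_nhds (s := {0}ᶜ))
  have hev := eventually_eval_ne P h0 g (by simpa [g] using hsP)
  obtain ⟨ε, hc, hn, hPε⟩ := (hcount.and (hnear.and hev)).exists
  rw [hPdef, map_mul, map_mul] at hPε
  have q1 := left_ne_zero_of_mul (left_ne_zero_of_mul hPε)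
  have q2 := right_ne_zero_of_mul (left_ne_zero_of_mul hPε)
  have q3 := right_ne_zero_of_mul hPε
  have hd1' := hd1.resolve_right fun H => H _ q1 ((le_encard_iff_exists _ _).2 hc.ge)
  have hd2' := hd2.resolve_left fun H => by
    have := ((le_encard_iff_exists _ _).1 (H _ q2)).trans hc.le
    rw [Nat.cast_le] at this
    omega
  have hd3' := hd3.resolve_left fun H => by
    obtain ⟨u, v, huv, hz, hb⟩ := H _ q3
    obtain ⟨τ, hτ⟩ := hn u v huv hz
    have hb' : badProd u v ≠ 0 := by
      refine mul_ne_zero (Finset.prod_ne_zero_iff.2 fun i _ => (hτ i).1) ?_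
      refine Finset.prod_ne_zero_iff.2 fun i _ => Finset.prod_ne_zero_iff.2 fun j hj h => ?_
      have hij := Finset.ne_of_mem_erase hj
      have e : v j / u j = v i / u i := by
        rw [div_eq_div_iff (hτ j).1 (hτ i).1]; linear_combination h
      have a1 := (hτ i).2
      have a2 := (hτ j).2
      rw [e] at a2
      have hne : ((τ i : ℕ) : ℤ) - (τ j : ℕ) ≠ 0 := by
        intro h
        apply hij
        apply τ.injective
        apply Fin.ext
        omega
      have h3 : (1:ℝ) ≤ ‖((τ i : ℕ) : ℂ) - (τ j : ℕ)‖ := by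
        have h4 := Int.one_le_abs hne
        have h5 : ((τ i : ℕ) : ℂ) - (τ j : ℕ) = (((τ i : ℕ) : ℤ) - (τ j : ℕ) : ℤ) := by push_cast; rfl
        rw [h5, Complex.norm_intCast]
        exact_mod_cast h4
      have h6 : ((τ i : ℕ) : ℂ) - (τ j : ℕ) = (v i / u i - (τ j : ℕ)) - (v i / u i - (τ i : ℕ)) := by
        ring
      rw [h6] at h3
      have := norm_sub_le (v i / u i - ((τ j : ℕ) : ℂ)) (v i / u i - (τ i : ℕ))
      linarith
    exact hb' hb
  refine ⟨P, hP, fun h hh => ?_⟩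
  rw [hPdef, map_mul, map_mul] at hh
  have w1 := left_ne_zero_of_mul (left_ne_zero_of_mul hh)
  have w2 := right_ne_zero_of_mul (left_ne_zero_of_mul hh)
  have w3 := right_ne_zero_of_mul hh
  constructor
  · apply le_antisymm
    · have := hd2' h w2
      beta_reduce at this
      rw [le_encard_iff_exists, not_le] at this
      rw [Nat.cast_add, Nat.cast_one] at this
      exact Order.le_of_lt_add_one this
    · exact (le_encard_iff_exists _ _).1 (hd1' h w1)
  · intro u v huv hz hb
    exact hd3' h w3 ⟨u, v, huv, hz, hb⟩

/-- coefficient vector of the product form -/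
def cvec (r : ℕ) {n : ℕ} (lam : Fin n → ℕ) (u v : Fin n → ℂ) : Fin (r+1) → ℂ :=
  fun m => (bprod lam u v).coeff (r - m)

lemma binForm_isHomogeneous (r : ℕ) (a : Fin (r+1) → ℂ) : (binForm r a).IsHomogeneous r := by
  refine IsHomogeneous.sum _ _ _ fun i _ => ?_
  have h1 : (r - (i:ℕ)) + (i:ℕ) = r := by omega
  have := ((isHomogeneous_C (Fin 2) (a i)).mul (isHomogeneous_X_pow (R := ℂ) (0 : Fin 2) (r - i))).mul
    (isHomogeneous_X_pow (R := ℂ) (1 : Fin 2) (i : ℕ))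
  rwa [zero_add, h1] at this

lemma prodForm_isHomogeneous (r : ℕ) {n : ℕ} (lam : Fin n → ℕ) (hr : ∑ i, lam i = r) (t : ℂ)
    (u v : Fin n → ℂ) :
    (C t * ∏ i, (linForm (u i) (v i)) ^ lam i : MvPolynomial (Fin 2) ℂ).IsHomogeneous r := by
  have h1 : ∀ i, (linForm (u i) (v i)).IsHomogeneous 1 := fun i =>
    (by simpa using (isHomogeneous_C (Fin 2) (u i)).mul (isHomogeneous_X ℂ (0 : Fin 2))
      : (C (u i) * X 0 : MvPolynomial (Fin 2) ℂ).IsHomogeneous 1).add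
    (by simpa using (isHomogeneous_C (Fin 2) (v i)).mul (isHomogeneous_X ℂ (1 : Fin 2)))
  have h2 := IsHomogeneous.prod Finset.univ (fun i => (linForm (u i) (v i)) ^ lam i) lam
    (fun i _ => by simpa using (h1 i).pow (lam i))
  have h3 := (isHomogeneous_C (Fin 2) t).mul h2
  rwa [hr, zero_add] at h3

lemma aeval_binForm (r : ℕ) (a : Fin (r+1) → ℂ) (m : Fin (r+1)) :
    (aeval ![Polynomial.X, (1 : Polynomial ℂ)] (binForm r a)).coeff (r - m) = a m := by
  rw [binForm, map_sum, Polynomial.finset_sum_coeff, Finset.sum_eq_single m]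
  · simp [← Polynomial.C_eq_algebraMap]
  · intro b _ hb
    have : r - (m:ℕ) ≠ r - (b:ℕ) := by
      intro h; apply hb; apply Fin.ext; omega
    simp [← Polynomial.C_eq_algebraMap, Polynomial.coeff_X_pow, this]
  · simp

lemma aeval_prodForm {n : ℕ} (lam : Fin n → ℕ) (t : ℂ) (u v : Fin n → ℂ) :
    aeval ![Polynomial.X, (1 : Polynomial ℂ)] (C t * ∏ i, (linForm (u i) (v i)) ^ lam i)
      = Polynomial.C t * bprod lam u v := by
  simp [bprod, linForm, ← Polynomial.C_eq_algebraMap, map_prod]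

lemma coeff_ext (r : ℕ) (p q : Polynomial ℂ) (hp : p.natDegree ≤ r) (hq : q.natDegree ≤ r)
    (h : ∀ m : Fin (r+1), p.coeff (r - m) = q.coeff (r - m)) : p = q := by
  ext k
  by_cases hk : k ≤ r
  · have := h ⟨r - k, by omega⟩
    simpa [Nat.sub_sub_self hk] using this
  · rw [Polynomial.coeff_eq_zero_of_natDegree_lt (by omega),
      Polynomial.coeff_eq_zero_of_natDegree_lt (by omega)]

lemma binForm_eq_iff_s3 (r : ℕ) {n : ℕ} (lam : Fin n → ℕ) (hr : ∑ i, lam i = r)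
    (a : Fin (r+1) → ℂ) (t : ℂ) (u v : Fin n → ℂ) :
    binForm r a = C t * ∏ i, (linForm (u i) (v i)) ^ lam i ↔ a = t • cvec r lam u v := by
  constructor
  · intro h
    ext m
    rw [← aeval_binForm r a m, h, aeval_prodForm]
    simp [cvec]
  · intro h
    have e : aeval ![Polynomial.X, (1 : Polynomial ℂ)] (binForm r a)
        = aeval ![Polynomial.X, (1 : Polynomial ℂ)] (C t * ∏ i, (linForm (u i) (v i)) ^ lam i) := by
      apply coeff_ext r
      · rw [binForm, map_sum]
        refine Polynomial.natDegree_sum_le_of_forall_le _ _ fun i _ => ?_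
        have : aeval ![Polynomial.X, (1 : Polynomial ℂ)]
          (C (a i) * X 0 ^ (r - (i : ℕ)) * X 1 ^ (i : ℕ) : MvPolynomial (Fin 2) ℂ)
            = Polynomial.C (a i) * Polynomial.X ^ (r - (i:ℕ)) := by
          simp [← Polynomial.C_eq_algebraMap]
        rw [this]
        exact (Polynomial.natDegree_C_mul_X_pow_le _ _).trans (Nat.sub_le _ _)
      · rw [aeval_prodForm]
        refine (Polynomial.natDegree_C_mul_le _ _).trans ?_
        exact (bprod_natDegree_le lam u v).trans hr.le
      · intro m
        rw [aeval_binForm, aeval_prodForm, h]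
        simp [cvec]
    rw [← Polynomial.homogenize_eq_of_isHomogeneous (binForm_isHomogeneous r a) rfl, e]
    exact Polynomial.homogenize_eq_of_isHomogeneous (prodForm_isHomogeneous r lam hr t u v) rfl

lemma hval_eq_cvec (r : ℕ) {n : ℕ} (lam : Fin n → ℕ) (h : Fin n × Fin (r+1) → ℂ)
    (u v : Fin n → ℂ) (k : Fin n) :
    hval r lam h u v k = ∑ m, h (k, m) * cvec r lam u v m := rfl

lemma bprod_count {n : ℕ} (lam : Fin n → ℕ) (z : Fin n → ℂ) (c : ℂ) :
    (bprod lam 1 z).roots.count c = ∑ i, if -z i = c then lam i else 0 := by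
  classical
  rw [bprod, Polynomial.roots_prod]
  · rw [Multiset.count_bind, Finset.sum_eq_multiset_sum]
    congr 1
    refine Multiset.map_congr rfl fun i _ => ?_
    have : (Polynomial.C ((1 : Fin n → ℂ) i) * Polynomial.X + Polynomial.C (z i))
        = Polynomial.X - Polynomial.C (-z i) := by simp
    rw [this, Polynomial.roots_pow, Polynomial.roots_X_sub_C, Multiset.count_nsmul,
      Multiset.count_singleton]
    simp [eq_comm]
  · exact (bprod_one_monic lam z).ne_zero

lemma bprod_count_inj {n : ℕ} (lam : Fin n → ℕ) (z : Fin n → ℂ) (hz : Function.Injective z)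
    (j : Fin n) : (bprod lam 1 z).roots.count (-z j) = lam j := by
  rw [bprod_count, Finset.sum_eq_single j]
  · simp
  · intro b _ hb
    rw [if_neg]
    intro h
    exact hb (hz (neg_injective h))
  · simp

lemma bprod_eq_perm {n : ℕ} (lam : Fin n → ℕ) (hlam : ∀ i, 1 ≤ lam i) (z z' : Fin n → ℂ)
    (hz : Function.Injective z) (hz' : Function.Injective z')
    (h : bprod lam 1 z = bprod lam 1 z') :
    ∃ τ : Equiv.Perm (Fin n), lam ∘ τ = lam ∧ z' = z ∘ τ := by
  classical
  have h1 : ∀ j, ∃ i, z i = z' j := by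
    intro j
    by_contra! hc
    have h2 := bprod_count_inj lam z' hz' j
    rw [← h, bprod_count, Finset.sum_eq_zero] at h2
    · have := hlam j; omega
    · intro i _
      rw [if_neg]
      intro h3
      exact hc i (neg_injective h3)
  choose τ hτ using h1
  have hinj : Function.Injective τ := by
    intro a b hab
    apply hz'
    rw [← hτ, ← hτ, hab]
  refine ⟨Equiv.ofBijective τ (Finite.injective_iff_bijective.1 hinj), ?_, ?_⟩
  · ext j
    have e1 := bprod_count_inj lam z' hz' j
    have e2 := bprod_count_inj lam z hz (τ j)
    rw [hτ, h, e1] at e2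
    exact e2.symm
  · ext j
    exact (hτ j).symm

lemma bprod_perm {n : ℕ} (lam : Fin n → ℕ) (z : Fin n → ℂ) (τ : Equiv.Perm (Fin n))
    (hτ : lam ∘ τ = lam) : bprod lam 1 (z ∘ τ) = bprod lam 1 z := by
  rw [bprod, bprod]
  refine Eq.trans ?_ (Equiv.prod_comp τ _)
  refine Finset.prod_congr rfl fun i _ => ?_
  have := congrFun hτ i
  simp only [Function.comp] at this
  simp [this]

lemma bprod_scale {n : ℕ} (lam : Fin n → ℕ) (u v : Fin n → ℂ) (hu : ∀ i, u i ≠ 0) :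
    bprod lam u v = Polynomial.C (∏ i, u i ^ lam i) * bprod lam 1 (fun i => v i / u i) := by
  rw [bprod, bprod, map_prod, ← Finset.prod_mul_distrib]
  refine Finset.prod_congr rfl fun i _ => ?_
  rw [map_pow, ← mul_pow]
  congr 1
  rw [mul_add, ← Polynomial.C_mul, mul_div_cancel₀ _ (hu i)]
  simp

lemma stab_card (r : ℕ) {n : ℕ} (lam : Fin n → ℕ) (hr : ∑ i, lam i = r) :
    Nat.card {τ : Equiv.Perm (Fin n) // lam ∘ τ = lam}
      = ∏ jj ∈ Finset.range (r+1), Nat.factorial (multOf lam jj) := by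
  classical
  rw [Nat.card_eq_fintype_card, DomMulAct.stabilizer_card']
  have : ∀ jj, Fintype.card {a // lam a = jj} = multOf lam jj := fun jj => by
    rw [multOf, Fintype.card_subtype]
  simp only [this]
  refine Finset.prod_subset ?_ ?_
  · intro j hj
    obtain ⟨i, -, rfl⟩ := Finset.mem_image.1 hj
    rw [Finset.mem_range, ← hr]
    exact Nat.lt_succ_of_le (Finset.single_le_sum (f := lam) (fun _ _ => Nat.zero_le _)
      (Finset.mem_univ i))
  · intro j _ hj
    have : multOf lam j = 0 := by
      rw [multOf, Finset.card_eq_zero, Finset.filter_eq_empty_iff]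
      intro i _ hi
      exact hj (Finset.mem_image.2 ⟨i, Finset.mem_univ _, hi⟩)
    rw [this]; rfl

theorem lines_count (r : ℕ) {n : ℕ} (lam : Fin n → ℕ) (hlam : ∀ i, 1 ≤ lam i)
    (hr : ∑ i, lam i = r) (h : Fin n × Fin (r+1) → ℂ)
    (hbad : ∀ u v : Fin n → ℂ, (∀ i, u i ≠ 0 ∨ v i ≠ 0) → (∀ k, hval r lam h u v k = 0) →
        badProd u v ≠ 0) :
    (∏ jj ∈ Finset.range (r+1), Nat.factorial (multOf lam jj)) *
          {L : Submodule ℂ (Fin (r+1) → ℂ) | Module.finrank ℂ L = 1 ∧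
            (L : Set (Fin (r+1) → ℂ)) ⊆ crlCone r n lam ∧
            ∀ x ∈ L, ∀ i : Fin n, ∑ m : Fin (r+1), h (i, m) * x m = 0}.ncard
      = {z : Fin n → ℂ | ∀ k, hval r lam h 1 z k = 0}.ncard := by
  classical
  set Z := {z : Fin n → ℂ | ∀ k, hval r lam h 1 z k = 0} with hZ
  set Λ := {L : Submodule ℂ (Fin (r+1) → ℂ) | Module.finrank ℂ L = 1 ∧
            (L : Set (Fin (r+1) → ℂ)) ⊆ crlCone r n lam ∧
            ∀ x ∈ L, ∀ i : Fin n, ∑ m : Fin (r+1), h (i, m) * x m = 0} with hΛ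
  have hinj : ∀ z ∈ Z, Function.Injective z := by
    intro z hz a b hab
    by_contra hne
    refine hbad 1 z (fun i => Or.inl one_ne_zero) hz ?_
    refine mul_eq_zero_of_right _ ?_
    refine Finset.prod_eq_zero (Finset.mem_univ a) ?_
    refine Finset.prod_eq_zero (Finset.mem_erase.2 ⟨Ne.symm hne, Finset.mem_univ b⟩) ?_
    simp [hab]
  have hc0 : ∀ z : Fin n → ℂ, cvec r lam 1 z 0 = 1 := by
    intro z
    simpa [cvec] using bprod_one_coeff r lam hr z
  have hcne : ∀ z : Fin n → ℂ, cvec r lam 1 z ≠ 0 := by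
    intro z h0
    have := hc0 z
    rw [h0] at this
    simp at this
  have hspan : ∀ z ∈ Z, Submodule.span ℂ {cvec r lam 1 z} ∈ Λ := by
    intro z hz
    refine ⟨finrank_span_singleton (hcne z), ?_, ?_⟩
    · intro x hx
      obtain ⟨c, rfl⟩ := Submodule.mem_span_singleton.1 hx
      exact ⟨c, 1, z, (binForm_eq_iff_s3 r lam hr _ _ _ _).2 rfl⟩
    · intro x hx k
      obtain ⟨c, rfl⟩ := Submodule.mem_span_singleton.1 hx
      have := hz k
      rw [hval_eq_cvec] at this
      have e : ∑ m : Fin (r+1), h (k, m) * (c • cvec r lam 1 z) m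
          = c * ∑ m, h (k, m) * cvec r lam 1 z m := by
        rw [Finset.mul_sum]
        refine Finset.sum_congr rfl fun m _ => ?_
        simp only [Pi.smul_apply, smul_eq_mul]; ring
      rw [e, this, mul_zero]
  have hsurj : ∀ L : Λ, ∃ z : Z, Submodule.span ℂ {cvec r lam 1 z} = (L : Submodule ℂ _) := by
    rintro ⟨L, hL1, hL2, hL3⟩
    obtain ⟨⟨a, haL⟩, ha0, hspanL⟩ := finrank_eq_one_iff'.1 hL1
    have ha0' : a ≠ 0 := fun h => ha0 (Subtype.ext h)
    obtain ⟨t, u, v, hform⟩ := hL2 haL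
    rw [binForm_eq_iff_s3 r lam hr] at hform
    have ht : t ≠ 0 := by rintro rfl; simp at hform; exact ha0' hform
    have huv : ∀ i, u i ≠ 0 ∨ v i ≠ 0 := by
      intro i
      by_contra! hc
      apply ha0'
      have : bprod lam u v = 0 := by
        refine Finset.prod_eq_zero (Finset.mem_univ i) ?_
        have := hlam i
        rw [hc.1, hc.2, pow_eq_zero_iff (by omega)]
        simp
      rw [hform]
      ext m
      simp [cvec, this]
    have hsol : ∀ k, hval r lam h u v k = 0 := by
      intro k
      have h1 := hL3 a haL k
      have e : ∑ m : Fin (r+1), h (k, m) * a m = t * hval r lam h u v k := by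
        rw [hval_eq_cvec, Finset.mul_sum, hform]
        refine Finset.sum_congr rfl fun m _ => ?_
        simp only [Pi.smul_apply, smul_eq_mul]; ring
      rw [e] at h1
      exact (mul_eq_zero.1 h1).resolve_left ht
    have hu : ∀ i, u i ≠ 0 := by
      intro i
      have := left_ne_zero_of_mul (hbad u v huv hsol)
      exact Finset.prod_ne_zero_iff.1 this i (Finset.mem_univ i)
    set s := ∏ i, u i ^ lam i with hs
    have hs0 : s ≠ 0 := Finset.prod_ne_zero_iff.2 fun i _ => pow_ne_zero _ (hu i)
    have hcv : cvec r lam u v = s • cvec r lam 1 (fun i => v i / u i) := by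
      ext m
      simp only [cvec, Pi.smul_apply, smul_eq_mul]
      rw [bprod_scale lam u v hu, Polynomial.coeff_C_mul]
    refine ⟨⟨fun i => v i / u i, ?_⟩, ?_⟩
    · intro k
      have h1 := hsol k
      have e : hval r lam h u v k = s * hval r lam h 1 (fun i => v i / u i) k := by
        rw [hval_eq_cvec, hval_eq_cvec, Finset.mul_sum, hcv]
        refine Finset.sum_congr rfl fun m _ => ?_
        simp only [Pi.smul_apply, smul_eq_mul]; ring
      rw [e] at h1
      exact (mul_eq_zero.1 h1).resolve_left hs0
    · have ha : a = (t * s) • cvec r lam 1 (fun i => v i / u i) := by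
        rw [hform, hcv, smul_smul]
      have hLa : L = Submodule.span ℂ {a} := by
        apply le_antisymm
        · intro x hx
          obtain ⟨c, hc⟩ := hspanL ⟨x, hx⟩
          exact Submodule.mem_span_singleton.2 ⟨c, congrArg Subtype.val hc⟩
        · rw [Submodule.span_singleton_le_iff_mem]; exact haL
      change _ = L
      rw [hLa, ha]
      exact (Submodule.span_singleton_smul_eq (IsUnit.mk0 _ (mul_ne_zero ht hs0)) _).symm
  choose σ hσ using hsurj
  have hzperm : ∀ z ∈ Z, ∀ τ : Equiv.Perm (Fin n), lam ∘ τ = lam → z ∘ τ ∈ Z := by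
    intro z hz τ hτ k
    have := hz k
    rw [hval] at this ⊢
    rw [bprod_perm lam z τ hτ]
    exact this
  rw [← stab_card r lam hr, ← Nat.card_coe_set_eq, ← Nat.card_coe_set_eq, ← Nat.card_prod]
  refine Nat.card_eq_of_bijective
    (fun x : {τ : Equiv.Perm (Fin n) // lam ∘ τ = lam} × Λ =>
      (⟨(σ x.2 : Fin n → ℂ) ∘ x.1.1, hzperm _ (σ x.2).2 x.1.1 x.1.2⟩ : Z)) ⟨?_, ?_⟩
  · rintro ⟨⟨τ, hτ⟩, L⟩ ⟨⟨τ', hτ'⟩, L'⟩ hEq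
    have hEq' : (σ L : Fin n → ℂ) ∘ τ = (σ L' : Fin n → ℂ) ∘ τ' := congrArg Subtype.val hEq
    have hb : bprod lam 1 (σ L : Fin n → ℂ) = bprod lam 1 (σ L' : Fin n → ℂ) := by
      rw [← bprod_perm lam _ τ hτ, hEq', bprod_perm lam _ τ' hτ']
    have hLL : L = L' := by
      apply Subtype.ext
      have hcc : cvec r lam 1 (σ L : Fin n → ℂ) = cvec r lam 1 (σ L' : Fin n → ℂ) := by
        funext m
        simp only [cvec, hb]
      rw [← hσ L, ← hσ L', hcc]
    subst hLL
    have : τ = τ' := by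
      ext i
      have := hinj _ (σ L).2 (congrFun hEq' i)
      rw [this]
    subst this
    rfl
  · rintro ⟨z, hz⟩
    let L : Λ := ⟨_, hspan z hz⟩
    have h1 : Submodule.span ℂ {cvec r lam 1 (σ L : Fin n → ℂ)}
        = Submodule.span ℂ {cvec r lam 1 z} := hσ L
    have h2 : cvec r lam 1 (σ L : Fin n → ℂ) ∈ Submodule.span ℂ {cvec r lam 1 z} := by
      rw [← h1]; exact Submodule.mem_span_singleton_self _
    obtain ⟨c, hc⟩ := Submodule.mem_span_singleton.1 h2
    have hc1 : c = 1 := by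
      have := congrFun hc 0
      rw [Pi.smul_apply, hc0, hc0] at this
      simpa using this
    rw [hc1, one_smul] at hc
    have hb : bprod lam 1 (σ L : Fin n → ℂ) = bprod lam 1 z :=
      coeff_ext r _ _ ((bprod_natDegree_le lam _ _).trans hr.le)
        ((bprod_natDegree_le lam _ _).trans hr.le) (fun m => (congrFun hc m).symm)
    obtain ⟨τ, hτ, hzτ⟩ := bprod_eq_perm lam hlam _ _ (hinj _ (σ L).2) (hinj z hz) hb
    exact ⟨(⟨τ, hτ⟩, L), Subtype.ext hzτ.symm⟩

/-- the degree of `Δ_λ ⊆ ℙ^r` equals `(n!/(m_1!⋯m_k!))·λ_1⋯λ_n`: a generic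
linear subspace of complementary dimension (cut out by `n` generic linear forms `h(i,·)`)
meets `Δ_λ` in exactly that many points (counted as lines of the cone). -/
theorem crl_degree (r n : ℕ) (lam : Fin n → ℕ) (hpart : isPartitionOf r n lam) :
    ∃ P : MvPolynomial (Fin n × Fin (r+1)) ℂ, P ≠ 0 ∧
      ∀ h : Fin n × Fin (r+1) → ℂ, eval h P ≠ 0 →
        (∏ jj ∈ Finset.range (r+1), Nat.factorial (multOf lam jj)) *
          {L : Submodule ℂ (Fin (r+1) → ℂ) | Module.finrank ℂ L = 1 ∧
            (L : Set (Fin (r+1) → ℂ)) ⊆ crlCone r n lam ∧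
            ∀ x ∈ L, ∀ i : Fin n, ∑ m : Fin (r+1), h (i, m) * x m = 0}.ncard
        = Nat.factorial n * ∏ i, lam i := by
  obtain ⟨hlam, hr⟩ := hpart
  obtain ⟨P, hP, hgen⟩ := generic_count r lam hlam hr
  refine ⟨P, hP, fun h hh => ?_⟩
  obtain ⟨hcount, hbad⟩ := hgen h hh
  rw [lines_count r lam hlam hr h hbad, Set.ncard, hcount]
  exact ENat.toNat_coe _
end
end
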